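/- arXiv:2601.10163 — 6 statements merged into one kernel-verified Lean document; each statement's English description precedes it below -/
import Mathlib

section
/- Under the Perron setup, let c ≥ 1 be a real constant and let v ∈ U be a vertex having a neighbor u ∈ U such that x_v ≤ x_u, u has at most cρ/4.5 neighbors in W \ W*, and x_u = β x_{u*}. Then the number of vertices of W* that are NOT adjacent to v is at least (β − c/4.5)ρ − 2r + (1 − β). -/
section PerronSetup

variable {V : Type*} [Fintype V] [DecidableEq V]

/-- The number of neighbors of `w` inside the vertex set `S`. -/
def dIn (G : SimpleGraph V) [DecidableRel G.Adj] (S : Finset V) (w : V) : ℕ :=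
  (G.neighborFinset w ∩ S).card

/-- The quantity `f(w) = d_U(w) (x_{u*} - x_w) + (1/2) d_W(w) x_{u*}`. -/
noncomputable def fW (G : SimpleGraph V) [DecidableRel G.Adj] (U W : Finset V)
    (x : V → ℝ) (ustar : V) (w : V) : ℝ :=
  (dIn G U w : ℝ) * (x ustar - x w) + (1 / 2) * (dIn G W w : ℝ) * x ustar

/-- **Claim 2.3.** For `c ≥ 1` and `v ∈ U` having a neighbor `u ∈ U` with `x_v ≤ x_u`, `u` having at most `cρ/4.5` neighbors in `W \\ W*`, and `x_u = β x_{u*}`, the number of vertices of `W*` not adjacent to `v` is at least `(β - c/4.5)ρ - 2r + (1 - β)`. -/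
theorem claim_2_3
    {V : Type*} [Fintype V] [DecidableEq V]
    (G : SimpleGraph V) [DecidableRel G.Adj] (hconn : G.Connected)
    (r : ℕ) (hr : 1 ≤ r)
    (hfree : ∀ u v, G.Adj u v → (G.neighborFinset u ∩ G.neighborFinset v).card ≤ r)
    (hm : 1 ≤ G.edgeFinset.card)
    (ρ : ℝ) (x : V → ℝ) (hx : ∀ v, 0 < x v)
    (heig : (G.adjMatrix ℝ).mulVec x = ρ • x)
    (ustar : V) (hustar : ∀ v, x v ≤ x ustar)
    (U W Wstar : Finset V)
    (hU : U = G.neighborFinset ustar)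
    (hW : W = Finset.univ \ insert ustar U)
    (hWstar : Wstar = W.filter (fun w => (1 - 4.5 * r / ρ) * x ustar ≤ x w))
    (c : ℝ) (hc : 1 ≤ c)
    (v u : V) (hv : v ∈ U) (hu : u ∈ U) (huv : G.Adj u v) (hxv : x v ≤ x u)
    (hudeg : (dIn G (W \ Wstar) u : ℝ) ≤ c * ρ / 4.5)
    (β : ℝ) (hβ : x u = β * x ustar)
    :
    ((Wstar \ G.neighborFinset v).card : ℝ) ≥
      (β - c / 4.5) * ρ - 2 * r + (1 - β) := by
  subst hU
  have hux : G.Adj ustar u := by simpa using hu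
  have hvx : G.Adj ustar v := by simpa using hv
  have hpos := hx ustar
  have hsum : ∑ w ∈ G.neighborFinset u, x w = ρ * x u := by
    have h := congrFun heig u
    rwa [SimpleGraph.adjMatrix_mulVec_apply, Pi.smul_apply, smul_eq_mul] at h
  have hvN : v ∈ G.neighborFinset u := by simpa using huv
  -- Bound every neighbor of `u` other than `v` by the maximum weight.
  have hdeg : ρ * β ≤ β + ((G.neighborFinset u).card - 1) := by
    rw [← Finset.add_sum_erase _ _ hvN] at hsum
    have h := Finset.sum_le_card_nsmul ((G.neighborFinset u).erase v) x (x ustar)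
      fun w _ => hustar w
    rw [nsmul_eq_mul, Finset.cast_card_erase_of_mem hvN] at h
    refine le_of_mul_le_mul_right ?_ hpos
    rw [hβ] at hsum hxv
    linarith
  have hcover : (G.neighborFinset u).card ≤ 1 +
      (G.neighborFinset ustar ∩ G.neighborFinset u).card +
      dIn G (W \ Wstar) u + (G.neighborFinset u ∩ Wstar).card := by
    have hsub : G.neighborFinset u ⊆ {ustar} ∪ (G.neighborFinset ustar ∩ G.neighborFinset u) ∪
        (G.neighborFinset u ∩ (W \ Wstar)) ∪ (G.neighborFinset u ∩ Wstar) := by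
      intro w hw
      simp only [hW, Finset.mem_union, Finset.mem_inter, Finset.mem_sdiff, Finset.mem_univ,
        Finset.mem_insert, Finset.mem_singleton]
      tauto
    refine (Finset.card_le_card hsub).trans ?_
    refine (Finset.card_union_le _ _).trans (Nat.add_le_add_right ?_ _)
    refine (Finset.card_union_le _ _).trans (Nat.add_le_add_right ?_ _)
    exact (Finset.card_union_le _ _).trans (by simp)
  have hnotW : ustar ∉ Wstar := by simp [hWstar, hW]
  -- The vertex `ustar` is a common neighbor of `u` and `v` outside `Wstar`.
  have hcommon : (G.neighborFinset u ∩ Wstar ∩ G.neighborFinset v).card + 1 ≤ r := by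
    refine le_trans ?_ (hfree u v huv)
    rw [← Finset.card_insert_of_notMem (a := ustar) (by simp [hnotW])]
    refine Finset.card_le_card fun w hw => ?_
    rcases Finset.mem_insert.1 hw with rfl | hw
    · simp [hux.symm, hvx.symm]
    · simp only [Finset.mem_inter] at hw ⊢
      exact ⟨hw.1.1, hw.2⟩
  have hsplit : (G.neighborFinset u ∩ Wstar).card ≤
      (G.neighborFinset u ∩ Wstar ∩ G.neighborFinset v).card +
      (Wstar \ G.neighborFinset v).card := by
    rw [← Finset.card_inter_add_card_sdiff (G.neighborFinset u ∩ Wstar) (G.neighborFinset v)]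
    exact Nat.add_le_add_left (Finset.card_le_card
      (Finset.sdiff_subset_sdiff Finset.inter_subset_right subset_rfl)) _
  have hcount : (G.neighborFinset u).card + 1 ≤
      1 + r + dIn G (W \ Wstar) u + r + (Wstar \ G.neighborFinset v).card := by
    have := hfree ustar u hux
    omega
  have hcount' : ((G.neighborFinset u).card : ℝ) + 1 ≤
      1 + r + dIn G (W \ Wstar) u + r + (Wstar \ G.neighborFinset v).card := by
    exact_mod_cast hcount
  have hc' : c * ρ / 4.5 = c / 4.5 * ρ := by ring
  rw [hc'] at hudeg
  linarith

end PerronSetup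
end

section
/- Under the Perron setup, assume additionally that ρ ≥ 9r. Then for every w ∈ W*, f(w) ≥ (1/4) Σ_{v ∈ U, v ∉ N(w)} x_v, where the sum is over the non-neighbors of w in U. -/
/-- The eigenvalue equation at a vertex, as a sum over its neighborhood. -/
theorem sum_neighborFinset_of_eigenvector {V : Type*} [Fintype V]
    (G : SimpleGraph V) [DecidableRel G.Adj]
    {ρ : ℝ} {x : V → ℝ} (heig : (G.adjMatrix ℝ).mulVec x = ρ • x) (v : V) :
    ∑ u ∈ G.neighborFinset v, x u = ρ * x v := by
  simpa [SimpleGraph.adjMatrix_mulVec_apply] using congrFun heig v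

/-- A vertex at defect `X - a` from the maximal weight `X`, with `d` neighbors of total weight `P`
and `e` neighbors of total weight `T`, has a large value of `d * (X - a) + e * X / 2`. -/
theorem quarter_le_of_weight_balance {ρ X a d e P T S : ℝ} (hX : 0 < X) (haX : a ≤ X)
    (ha : X ≤ 2 * a) (hρ : 0 ≤ ρ) (hP : P ≤ d * X) (hT : T ≤ e * X)
    (he : 0 ≤ e) (hw : P + T = ρ * a) (hu : P + S = ρ * X) (hd : 0 ≤ d) :
    1 / 4 * S ≤ d * (X - a) + 1 / 2 * e * X := by
  suffices h : ρ * (X - a) ≤ 4 * d * (X - a) + e * X by linarith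
  rcases le_total ρ (4 * d) with h | h
  · nlinarith [mul_nonneg (sub_nonneg.2 h) (sub_nonneg.2 haX), mul_nonneg he hX.le]
  · have hsum : ρ * a ≤ d * X + e * X := by linarith
    rcases le_total X (4 * (X - a)) with h4 | h4
    · nlinarith [mul_nonneg hd (sub_nonneg.2 h4), mul_nonneg hρ (sub_nonneg.2 ha)]
    · nlinarith [mul_nonneg (sub_nonneg.2 h) (sub_nonneg.2 h4), mul_nonneg hρ (sub_nonneg.2 ha),
        mul_nonneg hρ hX.le]

/-- The weight of a finite set is at most its size times a bound on the weights. -/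
theorem sum_le_card_mul_of_le {V : Type*} {x : V → ℝ} {X : ℝ} (h : ∀ v, x v ≤ X)
    (S : Finset V) :
    ∑ v ∈ S, x v ≤ (S.card : ℝ) * X := by
  simpa using Finset.sum_le_card_nsmul S x X fun v _ => h v

section PerronSetup

variable {V : Type*} [Fintype V] [DecidableEq V]

/-- **Claim 2.4.** If moreover `ρ ≥ 9r`, then for every `w ∈ W*` we have `f(w) ≥ (1/4) Σ_{v ∈ U, v ∉ N(w)} x_v`. -/
theorem claim_2_4
    {V : Type*} [Fintype V] [DecidableEq V]
    (G : SimpleGraph V) [DecidableRel G.Adj] (hconn : G.Connected)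
    (r : ℕ) (hr : 1 ≤ r)
    (hfree : ∀ u v, G.Adj u v → (G.neighborFinset u ∩ G.neighborFinset v).card ≤ r)
    (hm : 1 ≤ G.edgeFinset.card)
    (ρ : ℝ) (x : V → ℝ) (hx : ∀ v, 0 < x v)
    (heig : (G.adjMatrix ℝ).mulVec x = ρ • x)
    (ustar : V) (hustar : ∀ v, x v ≤ x ustar)
    (U W Wstar : Finset V)
    (hU : U = G.neighborFinset ustar)
    (hW : W = Finset.univ \ insert ustar U)
    (hWstar : Wstar = W.filter (fun w => (1 - 4.5 * r / ρ) * x ustar ≤ x w))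
    (hρ : (9 * r : ℝ) ≤ ρ)
    :
    ∀ w ∈ Wstar, fW G U W x ustar w ≥
      (1 / 4) * ∑ v ∈ U \ G.neighborFinset w, x v := by
  intro w hw
  rw [hWstar, Finset.mem_filter] at hw
  obtain ⟨hwW, hxw⟩ := hw
  have hr' : (1 : ℝ) ≤ r := by exact_mod_cast hr
  have hρ0 : 0 < ρ := by linarith
  have hwu : ¬ G.Adj w ustar := by
    intro h
    simp [hW, hU, h.symm] at hwW
  have hNW : G.neighborFinset w ∩ W = G.neighborFinset w \ U := by
    ext v
    simp only [hW, Finset.mem_inter, Finset.mem_sdiff, Finset.mem_univ, true_and,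
      Finset.mem_insert, not_or, SimpleGraph.mem_neighborFinset]
    exact ⟨fun h => ⟨h.1, h.2.2⟩, fun h => ⟨h.1, fun hv => hwu (hv ▸ h.1), h.2⟩⟩
  have hbal_w : ∑ v ∈ G.neighborFinset w ∩ U, x v + ∑ v ∈ G.neighborFinset w ∩ W, x v
      = ρ * x w := by
    rw [hNW, Finset.sum_inter_add_sum_sdiff, sum_neighborFinset_of_eigenvector G heig]
  have hbal_u : ∑ v ∈ G.neighborFinset w ∩ U, x v + ∑ v ∈ U \ G.neighborFinset w, x v
      = ρ * x ustar := by
    rw [Finset.inter_comm, Finset.sum_inter_add_sum_sdiff, hU,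
      sum_neighborFinset_of_eigenvector G heig]
  have hhalf : x ustar ≤ 2 * x w := by
    have hratio : 4.5 * (r : ℝ) / ρ ≤ 1 / 2 := by
      rw [div_le_iff₀ hρ0]
      linarith
    nlinarith [hx ustar]
  exact quarter_le_of_weight_balance (hx ustar) (hustar w) hhalf hρ0.le
    (sum_le_card_mul_of_le hustar _) (sum_le_card_mul_of_le hustar _)
    (Nat.cast_nonneg _) hbal_w hbal_u (Nat.cast_nonneg _)

end PerronSetup
end

section
/- Under the Perron setup with the section-3 hypotheses (m ≥ (240r)² and ρ² ≥ m − 1 + 2/(ρ − 1)), for every edge uv of G with both endpoints in U satisfying x_u ≥ x_v and x_u + x_v ≥ x_{u*}, the vertex u has at most 2ρ/4.5 neighbors in W \ W*. -/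
section PerronSetup

variable {V : Type*} [Fintype V] [DecidableEq V]

open Finset SimpleGraph

lemma dIn_eq_sum (G : SimpleGraph V) [DecidableRel G.Adj] (S : Finset V) (w : V) :
    (dIn G S w : ℝ) = ∑ a ∈ S, G.adjMatrix ℝ w a := by
  simp only [adjMatrix_apply, Finset.sum_boole, dIn]
  congr 2
  ext a
  simp [and_comm]

lemma adjMatrix_nonneg {V : Type*} (G : SimpleGraph V) [DecidableRel G.Adj] (a b : V) :
    0 ≤ G.adjMatrix ℝ a b := by
  rw [adjMatrix_apply]; split_ifs <;> norm_num

lemma adjMatrix_comm {V : Type*} (G : SimpleGraph V) [DecidableRel G.Adj] (a b : V) :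
    G.adjMatrix ℝ a b = G.adjMatrix ℝ b a := by
  simp [adjMatrix_apply, G.adj_comm]

lemma sum_dIn_comm (G : SimpleGraph V) [DecidableRel G.Adj] (S T : Finset V) :
    ∑ a ∈ S, (dIn G T a : ℝ) = ∑ b ∈ T, (dIn G S b : ℝ) := by
  simp_rw [dIn_eq_sum]
  exact sum_comm.trans <|
    sum_congr rfl fun _ _ => sum_congr rfl fun _ _ => adjMatrix_comm G _ _

/-- A sum over all vertices splits over a vertex, its neighbors and the remaining vertices. -/
lemma sum_univ_split (G : SimpleGraph V) [DecidableRel G.Adj] (z : V) (g : V → ℝ) :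
    ∑ v, g v = g z + ∑ v ∈ G.neighborFinset z, g v +
      ∑ v ∈ univ \ insert z (G.neighborFinset z), g v := by
  rw [← sum_sdiff (subset_univ (insert z (G.neighborFinset z))), sum_insert (by simp)]
  ring

lemma sum_adjMatrix_mul_eq {V : Type*} [Fintype V] (G : SimpleGraph V) [DecidableRel G.Adj]
    {ρ : ℝ} {x : V → ℝ}
    (heig : (G.adjMatrix ℝ).mulVec x = ρ • x) (v : V) :
    ∑ a, G.adjMatrix ℝ v a * x a = ρ * x v := by
  simpa [Matrix.mulVec, dotProduct] using congrFun heig v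

lemma sum_neighborFinset_eq {V : Type*} [Fintype V] (G : SimpleGraph V) [DecidableRel G.Adj]
    {ρ : ℝ} {x : V → ℝ}
    (heig : (G.adjMatrix ℝ).mulVec x = ρ • x) (v : V) :
    ∑ a ∈ G.neighborFinset v, x a = ρ * x v := by
  rw [← adjMatrix_mulVec_apply, heig]; simp

lemma sum_adjMatrix_mul_le_dIn (G : SimpleGraph V) [DecidableRel G.Adj] {x : V → ℝ} {M : ℝ}
    (hM : ∀ v, x v ≤ M) (S : Finset V) (v : V) :
    ∑ a ∈ S, G.adjMatrix ℝ v a * x a ≤ dIn G S v * M := by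
  rw [dIn_eq_sum, sum_mul]
  exact sum_le_sum fun a _ => mul_le_mul_of_nonneg_left (hM a) (adjMatrix_nonneg G v a)

lemma degree_le_sq {V : Type*} [Fintype V] (G : SimpleGraph V) [DecidableRel G.Adj]
    {ρ : ℝ} {x : V → ℝ}
    (hx : ∀ v, 0 < x v) (heig : (G.adjMatrix ℝ).mulVec x = ρ • x) (v : V) :
    (G.degree v : ℝ) ≤ ρ ^ 2 := by
  have h1 : ∀ a ∈ G.neighborFinset v, x v ≤ ρ * x a := fun a ha => by
    rw [← sum_neighborFinset_eq G heig]
    exact single_le_sum (f := x) (fun b _ => (hx b).le)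
      (by simpa [G.adj_comm] using ha)
  have h2 := card_nsmul_le_sum _ _ _ h1
  rw [← mul_sum, sum_neighborFinset_eq G heig, card_neighborFinset_eq_degree, nsmul_eq_mul] at h2
  exact le_of_mul_le_mul_right (by linarith) (hx v)

/-- A connected graph with at least two edges has a Perron eigenvalue exceeding `1`. -/
lemma one_lt_of_two_le_card_edgeFinset {V : Type*} [Fintype V] (G : SimpleGraph V)
    [DecidableRel G.Adj] (hconn : G.Connected) {ρ : ℝ} {x : V → ℝ} (hx : ∀ v, 0 < x v)
    (heig : (G.adjMatrix ℝ).mulVec x = ρ • x) (hm : 2 ≤ #G.edgeFinset) : 1 < ρ := by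
  obtain ⟨z⟩ := hconn.nonempty
  have hρ : 0 ≤ ρ := by
    have h := sum_neighborFinset_eq G heig z
    have h0 : 0 ≤ ∑ a ∈ G.neighborFinset z, x a := sum_nonneg fun a _ => (hx a).le
    exact nonneg_of_mul_nonneg_left (h ▸ h0) (hx z)
  by_contra! hle
  have hdeg : ∀ v, G.degree v ≤ 1 := fun v => by
    have := degree_le_sq G hx heig v
    have h1 : (G.degree v : ℝ) ≤ 1 := this.trans (by nlinarith)
    exact_mod_cast h1
  have h1 : ∑ v, G.degree v ≤ Fintype.card V := by
    simpa using sum_le_sum (s := univ) fun v _ => hdeg v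
  have h2 := hconn.card_vert_le_card_edgeSet_add_one
  rw [G.sum_degrees_eq_twice_card_edges] at h1
  rw [Nat.card_eq_fintype_card, Nat.card_eq_fintype_card, ← edgeFinset_card] at h2
  omega

/-- The edge count in terms of the partition into `z`, `N(z)` and the remaining vertices. -/
lemma card_edgeFinset_split (G : SimpleGraph V) [DecidableRel G.Adj] (z : V) {U W : Finset V}
    (hU : U = G.neighborFinset z) (hW : W = univ \ insert z U) :
    (#G.edgeFinset : ℝ) = #U + (∑ a ∈ U, (dIn G U a : ℝ)) / 2 + ∑ w ∈ W, (dIn G U w : ℝ) +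
      (∑ w ∈ W, (dIn G W w : ℝ)) / 2 := by
  have hdeg : ∀ v, (G.degree v : ℝ) = G.adjMatrix ℝ v z + dIn G U v + dIn G W v := fun v => by
    have h := sum_univ_split G z (fun a => G.adjMatrix ℝ v a)
    rw [← hU, ← hW, ← dIn_eq_sum, ← dIn_eq_sum, ← dIn_eq_sum] at h
    simpa [dIn] using h
  have h2 : (2 * #G.edgeFinset : ℝ) = ∑ v, (G.degree v : ℝ) := by
    exact_mod_cast G.sum_degrees_eq_twice_card_edges.symm
  have hz : (G.degree z : ℝ) = #U := by simp [hU]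
  have hadjU : ∑ v ∈ U, G.adjMatrix ℝ v z = #U := by
    rw [card_eq_sum_ones, Nat.cast_sum]
    exact sum_congr rfl fun v hv => by
      rw [hU, mem_neighborFinset, G.adj_comm] at hv
      simp [hv]
  have hadjW : ∑ v ∈ W, G.adjMatrix ℝ v z = 0 :=
    sum_eq_zero fun v hv => by
      have : ¬ G.Adj v z := fun h => by simp [hW, hU, h.symm] at hv
      simp [this]
  rw [sum_univ_split G z, ← hU, ← hW, hz, sum_congr rfl fun v _ => hdeg v,
    sum_congr (s₁ := W) rfl fun v _ => hdeg v] at h2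
  simp only [sum_add_distrib] at h2
  rw [hadjU, hadjW, sum_dIn_comm G U W] at h2
  linarith

/-- The second-order eigenvalue equation at `z`. -/
lemma sq_mul_eq_sum_dIn (G : SimpleGraph V) [DecidableRel G.Adj] {ρ : ℝ} {x : V → ℝ}
    (heig : (G.adjMatrix ℝ).mulVec x = ρ • x) (z : V) {U W : Finset V}
    (hU : U = G.neighborFinset z) (hW : W = univ \ insert z U) :
    ρ ^ 2 * x z = #U * x z + ∑ a ∈ U, dIn G U a * x a + ∑ w ∈ W, dIn G U w * x w := by
  have h1 : ρ ^ 2 * x z = ∑ b, dIn G U b * x b := by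
    rw [sq, mul_assoc, ← sum_neighborFinset_eq G heig z, ← hU, mul_sum]
    simp_rw [dIn_eq_sum, sum_mul]
    rw [sum_comm]
    refine sum_congr rfl fun a _ => ?_
    rw [← sum_adjMatrix_mul_eq G heig a]
    exact sum_congr rfl fun b _ => by rw [adjMatrix_comm]
  rw [h1, sum_univ_split G z, ← hU, ← hW]
  simp [dIn, hU]

/-- The total over ordered adjacent pairs in `U` of the positive part of `x a + x b - M`. -/
noncomputable def surplus (G : SimpleGraph V) [DecidableRel G.Adj] (U : Finset V) (x : V → ℝ)
    (M : ℝ) : ℝ :=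
  ∑ a ∈ U, ∑ b ∈ U, G.adjMatrix ℝ a b * max 0 (x a + x b - M)

lemma sum_adjMatrix_mul_add (G : SimpleGraph V) [DecidableRel G.Adj] (U : Finset V)
    (g : V → ℝ) :
    ∑ a ∈ U, ∑ b ∈ U, G.adjMatrix ℝ a b * (g a + g b) = 2 * ∑ a ∈ U, dIn G U a * g a := by
  simp_rw [mul_add, sum_add_distrib]
  rw [sum_comm (f := fun a b => G.adjMatrix ℝ a b * g b)]
  simp_rw [dIn_eq_sum, sum_mul, adjMatrix_comm G _ _]
  rw [two_mul]

lemma sum_fW_le (G : SimpleGraph V) [DecidableRel G.Adj] {ρ : ℝ} {x : V → ℝ}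
    (hx : ∀ v, 0 < x v) (heig : (G.adjMatrix ℝ).mulVec x = ρ • x) (z : V) {U W : Finset V}
    (hU : U = G.neighborFinset z) (hW : W = univ \ insert z U)
    (hρ2 : (#G.edgeFinset : ℝ) - 1 + 2 / (ρ - 1) ≤ ρ ^ 2) :
    ∑ w ∈ W, fW G U W x z w ≤ surplus G U x (x z) / 2 + x z - 2 / (ρ - 1) * x z := by
  have h1 := mul_le_mul_of_nonneg_right hρ2 (hx z).le
  rw [sq_mul_eq_sum_dIn G heig z hU hW, card_edgeFinset_split G z hU hW] at h1
  have h2 : 2 * ∑ a ∈ U, dIn G U a * (x a - x z / 2) ≤ surplus G U x (x z) := by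
    rw [← sum_adjMatrix_mul_add, surplus]
    refine sum_le_sum fun a _ => sum_le_sum fun b _ =>
      mul_le_mul_of_nonneg_left ?_ (adjMatrix_nonneg G a b)
    exact le_max_of_le_right (by linarith)
  simp only [fW, mul_sub, sum_add_distrib, sum_sub_distrib, ← sum_mul, ← mul_sum] at h2 ⊢
  linarith

lemma mul_le_add_dIn (G : SimpleGraph V) [DecidableRel G.Adj] {ρ : ℝ} {x : V → ℝ}
    (heig : (G.adjMatrix ℝ).mulVec x = ρ • x) {z : V}
    (hz : ∀ v, x v ≤ x z) {U W : Finset V}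
    (hU : U = G.neighborFinset z) (hW : W = univ \ insert z U) (v : V) :
    ρ * x v ≤ G.adjMatrix ℝ v z * x z + ∑ a ∈ U, G.adjMatrix ℝ v a * x a + dIn G W v * x z := by
  rw [← sum_adjMatrix_mul_eq G heig v, sum_univ_split G z, ← hU, ← hW]
  gcongr
  exact sum_adjMatrix_mul_le_dIn G hz W v

lemma fW_nonneg (G : SimpleGraph V) [DecidableRel G.Adj] {x : V → ℝ} (hx : ∀ v, 0 < x v)
    {z : V} (hz : ∀ v, x v ≤ x z) (U W : Finset V) (w : V) : 0 ≤ fW G U W x z w := by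
  have := sub_nonneg.2 (hz w)
  have := hx z
  unfold fW
  positivity

lemma sum_nonadj_le_two_mul_fW (G : SimpleGraph V) [DecidableRel G.Adj] {ρ : ℝ} {x : V → ℝ}
    (heig : (G.adjMatrix ℝ).mulVec x = ρ • x) {z : V}
    (hz : ∀ v, x v ≤ x z) {U W : Finset V}
    (hU : U = G.neighborFinset z) (hW : W = univ \ insert z U) {w : V} (hw : w ∈ W)
    (hd : ρ / 2 ≤ dIn G U w) :
    ∑ a ∈ U, (1 - G.adjMatrix ℝ w a) * x a ≤ 2 * fW G U W x z w := by
  have h1 := mul_le_add_dIn G heig hz hU hW w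
  have h2 := sum_neighborFinset_eq G heig z
  have h3 : G.adjMatrix ℝ w z = 0 := by
    have : ¬ G.Adj w z := fun h => by simp [hW, hU, h.symm] at hw
    simp [this]
  have h4 := mul_le_mul_of_nonneg_right hd (sub_nonneg.2 (hz w))
  rw [← hU] at h2
  simp only [sub_mul, one_mul, sum_sub_distrib, fW]
  rw [h3] at h1
  linarith

lemma half_dIn_mul_le_fW (G : SimpleGraph V) [DecidableRel G.Adj] {ρ : ℝ} {x : V → ℝ}
    (hx : ∀ v, 0 < x v) (heig : (G.adjMatrix ℝ).mulVec x = ρ • x) {z : V}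
    (hz : ∀ v, x v ≤ x z) {U W : Finset V}
    (hU : U = G.neighborFinset z) (hW : W = univ \ insert z U) {w : V} (hw : w ∈ W)
    (hd : dIn G U w ≤ ρ / 2) :
    dIn G U w * x z / 2 ≤ fW G U W x z w := by
  have h1 := mul_le_add_dIn G heig hz hU hW w
  have h2 := sum_adjMatrix_mul_le_dIn G hz U w
  have h3 : G.adjMatrix ℝ w z = 0 := by
    have : ¬ G.Adj w z := fun h => by simp [hW, hU, h.symm] at hw
    simp [this]
  have h4 := mul_le_mul_of_nonneg_right hd (hx w).le
  simp only [fW]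
  rw [h3] at h1
  linarith

lemma surplus_le_of_many (G : SimpleGraph V) [DecidableRel G.Adj] {r : ℕ} (hr : 1 ≤ r)
    (hfree : ∀ u v, G.Adj u v → #(G.neighborFinset u ∩ G.neighborFinset v) ≤ r)
    {x : V → ℝ} (hx : ∀ v, 0 < x v) {z : V} (hz : ∀ v, x v ≤ x z) {U S : Finset V}
    (hU : U = G.neighborFinset z) (hS : 5 * r ≤ #S) :
    surplus G U x (x z) ≤ ∑ w ∈ S, (∑ a ∈ U, (1 - G.adjMatrix ℝ w a) * x a) / 2 := by
  set A := G.adjMatrix ℝ with hA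
  set s : V → V → ℝ := fun a b => max 0 (x a + x b - x z) with hs
  have hs0 : ∀ a b, 0 ≤ s a b := fun a b => le_max_left _ _
  have hscomm : ∀ a b, s a b = s b a := fun a b => by simp only [hs, add_comm]
  have hr0 : (0 : ℝ) < r := by exact_mod_cast hr
  have hdU : ∀ a ∈ U, (dIn G U a : ℝ) ≤ r := fun a ha => by
    rw [hU, mem_neighborFinset] at ha
    rw [hU]
    exact_mod_cast hfree a z ha.symm
  have hrow : ∀ a ∈ U, ∑ b ∈ U, A a b * s a b ≤ r * x a := fun a ha => by
    have h1 : ∑ b ∈ U, A a b * s a b ≤ dIn G U a * x a := by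
      rw [dIn_eq_sum, sum_mul]
      refine sum_le_sum fun b _ => mul_le_mul_of_nonneg_left ?_ (adjMatrix_nonneg G a b)
      exact max_le (hx a).le (by linarith [hz b])
    exact h1.trans (mul_le_mul_of_nonneg_right (hdU a ha) (hx a).le)
  have hA1 : ∀ a b, A a b ≤ 1 := fun a b => by
    rw [hA, adjMatrix_apply]; split_ifs <;> norm_num
  have hA0 : ∀ a b, 0 ≤ A a b := adjMatrix_nonneg G
  have hcommon : ∀ a b, A a b * (4 * r) ≤
      A a b * ∑ w ∈ S, ((1 - A w a) + (1 - A w b)) := fun a b => by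
    by_cases hab : G.Adj a b
    · refine mul_le_mul_of_nonneg_left ?_ (hA0 a b)
      have h1 : ∑ w ∈ S, A w a * A w b ≤ r := by
        have h2 : ∑ w ∈ S, A w a * A w b ≤ ∑ w, A w a * A w b :=
          sum_le_sum_of_subset_of_nonneg (subset_univ _)
            fun w _ _ => mul_nonneg (hA0 _ _) (hA0 _ _)
        refine h2.trans ?_
        have h3 : ∑ w, A w a * A w b =
            (#(G.neighborFinset a ∩ G.neighborFinset b) : ℝ) := by
          simp only [hA, adjMatrix_apply, mul_ite, mul_one, mul_zero, ← ite_and, sum_boole]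
          congr 2
          ext w
          simp [G.adj_comm, and_comm]
        rw [h3]
        exact_mod_cast hfree a b hab
      have h4 : ∑ w ∈ S, (1 - A w a * A w b) ≤ ∑ w ∈ S, ((1 - A w a) + (1 - A w b)) :=
        sum_le_sum fun w _ => by nlinarith [hA1 w a, hA1 w b]
      have h5 : (5 * r : ℝ) ≤ #S := by exact_mod_cast hS
      simp only [sum_sub_distrib, sum_const, nsmul_eq_mul, mul_one] at h4
      linarith
    · simp [hA, hab]
  have hsum : 4 * r * surplus G U x (x z) ≤
      ∑ w ∈ S, 2 * ∑ a ∈ U, (1 - A w a) * (r * x a) := by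
    calc 4 * r * surplus G U x (x z)
        = ∑ a ∈ U, ∑ b ∈ U, (A a b * (4 * r)) * s a b := by
          simp only [surplus, mul_sum]
          exact sum_congr rfl fun _ _ => sum_congr rfl fun _ _ => by ring
      _ ≤ ∑ a ∈ U, ∑ b ∈ U, (A a b * ∑ w ∈ S, ((1 - A w a) + (1 - A w b))) * s a b :=
          sum_le_sum fun a _ => sum_le_sum fun b _ =>
            mul_le_mul_of_nonneg_right (hcommon a b) (hs0 a b)
      _ = ∑ w ∈ S, ∑ a ∈ U, ∑ b ∈ U,
            ((1 - A w a) * (A a b * s a b) + (1 - A w b) * (A a b * s a b)) := by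
          rw [sum_comm]
          simp_rw [mul_sum, sum_mul]
          rw [sum_comm (s := S), sum_comm]
          refine sum_congr rfl fun a _ => ?_
          rw [sum_comm]
          exact sum_congr rfl fun _ _ => sum_congr rfl fun _ _ => by ring
      _ = ∑ w ∈ S, 2 * ∑ a ∈ U, (1 - A w a) * ∑ b ∈ U, A a b * s a b := by
          refine sum_congr rfl fun w _ => ?_
          simp_rw [sum_add_distrib]
          rw [sum_comm (f := fun a b => (1 - A w b) * (A a b * s a b)), two_mul]
          simp_rw [mul_sum]
          congr 1
          exact sum_congr rfl fun a _ => sum_congr rfl fun b _ => by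
            rw [hscomm, hA, adjMatrix_comm G b a]
      _ ≤ _ := by
          refine sum_le_sum fun w _ => mul_le_mul_of_nonneg_left ?_ zero_le_two
          exact sum_le_sum fun a ha =>
            mul_le_mul_of_nonneg_left (hrow a ha) (sub_nonneg.2 (hA1 w a))
  have hrhs : ∑ w ∈ S, 2 * ∑ a ∈ U, (1 - A w a) * (r * x a) =
      4 * r * ∑ w ∈ S, (∑ a ∈ U, (1 - A w a) * x a) / 2 := by
    simp_rw [mul_sum, sum_div, mul_sum]
    exact sum_congr rfl fun _ _ => sum_congr rfl fun _ _ => by ring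
  rw [hrhs] at hsum
  exact le_of_mul_le_mul_left hsum (by positivity)

lemma surplus_le_of_few (G : SimpleGraph V) [DecidableRel G.Adj] {r : ℕ} (hr : 1 ≤ r)
    (hfree : ∀ u v, G.Adj u v → #(G.neighborFinset u ∩ G.neighborFinset v) ≤ r)
    {ρ : ℝ} {x : V → ℝ} (hx : ∀ v, 0 < x v) (heig : (G.adjMatrix ℝ).mulVec x = ρ • x)
    (hρ : 18 * r ≤ ρ) {z : V} (hz : ∀ v, x v ≤ x z) {U W S : Finset V}
    (hU : U = G.neighborFinset z) (hW : W = univ \ insert z U) (hSW : S ⊆ W)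
    (hS : #S ≤ 5 * r) :
    surplus G U x (x z) ≤ ∑ w ∈ W \ S, dIn G U w * x z / 2 := by
  have hr1 : (1 : ℝ) ≤ r := by exact_mod_cast hr
  have hdU : ∀ a ∈ U, (dIn G U a : ℝ) ≤ r := fun a ha => by
    rw [hU, mem_neighborFinset] at ha
    rw [hU]
    exact_mod_cast hfree a z ha.symm
  have hlow : ∀ a ∈ U, ρ * x a ≤ (1 + 6 * r + dIn G (W \ S) a) * x z := fun a ha => by
    have h1 := mul_le_add_dIn G heig hz hU hW a
    have h2 := sum_adjMatrix_mul_le_dIn G hz U a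
    have h3 : G.adjMatrix ℝ a z = 1 := by
      rw [hU, mem_neighborFinset, G.adj_comm] at ha
      simp [ha]
    have h4 : (dIn G W a : ℝ) ≤ 5 * r + dIn G (W \ S) a := by
      have h5 : (dIn G S a : ℝ) ≤ #S := by exact_mod_cast card_le_card inter_subset_right
      have h6 : (#S : ℝ) ≤ 5 * r := by exact_mod_cast hS
      rw [dIn_eq_sum, ← sum_sdiff hSW, ← dIn_eq_sum, ← dIn_eq_sum]
      linarith
    have h7 := mul_le_mul_of_nonneg_right h4 (hx z).le
    have h8 := mul_le_mul_of_nonneg_right (hdU a ha) (hx z).le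
    rw [h3] at h1
    linarith
  have hpair : ∀ a ∈ U, ∀ b ∈ U, 4 * r * max 0 (x a + x b - x z) ≤
      dIn G (W \ S) a * x z + dIn G (W \ S) b * x z := fun a ha b hb => by
    have hxz := hx z
    rcases le_total (x a + x b - x z) 0 with h | h
    · rw [max_eq_left h]
      simp only [mul_zero]
      positivity
    · rw [max_eq_right h]
      have h1 := hlow a ha
      have h2 := hlow b hb
      have h3 : x a + x b - x z ≤ x z := by linarith [hz a, hz b]
      have h4 : 4 * r * (x a + x b - x z) ≤ 4 * r * x z :=
        mul_le_mul_of_nonneg_left h3 (by positivity)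
      have h5 : ρ * x z ≤ ρ * (x a + x b) :=
        mul_le_mul_of_nonneg_left (by linarith) (by linarith)
      have h6 := mul_le_mul_of_nonneg_right hρ hxz.le
      have h7 := mul_le_mul_of_nonneg_right hr1 hxz.le
      linarith
  have hsum : 4 * r * surplus G U x (x z) ≤ 2 * ∑ a ∈ U, r * (dIn G (W \ S) a * x z) := by
    calc 4 * r * surplus G U x (x z)
        = ∑ a ∈ U, ∑ b ∈ U, G.adjMatrix ℝ a b * (4 * r * max 0 (x a + x b - x z)) := by
          simp only [surplus, mul_sum]
          exact sum_congr rfl fun _ _ => sum_congr rfl fun _ _ => by ring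
      _ ≤ ∑ a ∈ U, ∑ b ∈ U,
            G.adjMatrix ℝ a b * (dIn G (W \ S) a * x z + dIn G (W \ S) b * x z) :=
          sum_le_sum fun a ha => sum_le_sum fun b hb =>
            mul_le_mul_of_nonneg_left (hpair a ha b hb) (adjMatrix_nonneg G a b)
      _ = 2 * ∑ a ∈ U, dIn G U a * (dIn G (W \ S) a * x z) :=
          sum_adjMatrix_mul_add G U fun a => dIn G (W \ S) a * x z
      _ ≤ _ := by
          refine mul_le_mul_of_nonneg_left (sum_le_sum fun a ha => ?_) zero_le_two
          have := hx z
          exact mul_le_mul_of_nonneg_right (hdU a ha) (by positivity)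
  rw [← mul_sum, ← sum_mul, sum_dIn_comm] at hsum
  rw [← sum_div, ← sum_mul]
  exact le_of_mul_le_mul_left (hsum.trans_eq (by ring)) (show (0 : ℝ) < 4 * r by positivity)

lemma surplus_le_sum_fW (G : SimpleGraph V) [DecidableRel G.Adj] {r : ℕ} (hr : 1 ≤ r)
    (hfree : ∀ u v, G.Adj u v → #(G.neighborFinset u ∩ G.neighborFinset v) ≤ r)
    {ρ : ℝ} {x : V → ℝ} (hx : ∀ v, 0 < x v) (heig : (G.adjMatrix ℝ).mulVec x = ρ • x)
    (hρ : 18 * r ≤ ρ) {z : V} (hz : ∀ v, x v ≤ x z) {U W : Finset V}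
    (hU : U = G.neighborFinset z) (hW : W = univ \ insert z U) :
    surplus G U x (x z) ≤ ∑ w ∈ W, fW G U W x z w := by
  set S := W.filter fun w => ρ / 2 ≤ dIn G U w with hSdef
  have hSW : S ⊆ W := filter_subset _ _
  have hnn := fW_nonneg G hx hz U W
  rcases le_total (5 * r) #S with hS | hS
  · refine (surplus_le_of_many G hr hfree hx hz hU hS).trans ?_
    refine le_trans (sum_le_sum fun w hw => ?_)
      (sum_le_sum_of_subset_of_nonneg hSW fun w _ _ => hnn w)
    obtain ⟨hwW, hd⟩ := mem_filter.1 hw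
    linarith [sum_nonadj_le_two_mul_fW G heig hz hU hW hwW hd]
  · refine (surplus_le_of_few G hr hfree hx heig hρ hz hU hW hSW hS).trans ?_
    refine le_trans (sum_le_sum fun w hw => ?_)
      (sum_le_sum_of_subset_of_nonneg sdiff_subset fun w _ _ => hnn w)
    obtain ⟨hwW, hd⟩ := mem_sdiff.1 hw
    refine half_dIn_mul_le_fW G hx heig hz hU hW hwW ?_
    by_contra! h
    exact hd (mem_filter.2 ⟨hwW, h.le⟩)

/-- **Claim 3.1.** Under the section-3 hypotheses (`m ≥ (240r)²` and `ρ² ≥ m - 1 + 2/(ρ-1)`), for every edge `uv` with both ends in `U`, `x_u ≥ x_v` and `x_u + x_v ≥ x_{u*}`, the vertex `u` has at most `2ρ/4.5` neighbors in `W \\ W*`. -/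
theorem claim_3_1
    {V : Type*} [Fintype V] [DecidableEq V]
    (G : SimpleGraph V) [DecidableRel G.Adj] (hconn : G.Connected)
    (r : ℕ) (hr : 1 ≤ r)
    (hfree : ∀ u v, G.Adj u v → (G.neighborFinset u ∩ G.neighborFinset v).card ≤ r)
    (hm : 1 ≤ G.edgeFinset.card)
    (ρ : ℝ) (x : V → ℝ) (hx : ∀ v, 0 < x v)
    (heig : (G.adjMatrix ℝ).mulVec x = ρ • x)
    (ustar : V) (hustar : ∀ v, x v ≤ x ustar)
    (U W Wstar : Finset V)
    (hU : U = G.neighborFinset ustar)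
    (hW : W = Finset.univ \ insert ustar U)
    (hWstar : Wstar = W.filter (fun w => (1 - 4.5 * r / ρ) * x ustar ≤ x w))
    (hm2 : (240 * r) ^ 2 ≤ G.edgeFinset.card)
    (hρ2 : (G.edgeFinset.card : ℝ) - 1 + 2 / (ρ - 1) ≤ ρ ^ 2)
    (u v : V) (hu : u ∈ U) (hv : v ∈ U) (huv : G.Adj u v)
    (hxuv : x v ≤ x u) (hsum : x ustar ≤ x u + x v)
    :
    (dIn G (W \ Wstar) u : ℝ) ≤ 2 * ρ / 4.5 := by
  have hm3 : 57600 * r ^ 2 ≤ G.edgeFinset.card := by linarith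
  have hρ1 : 1 < ρ :=
    one_lt_of_two_le_card_edgeFinset G hconn hx heig (by nlinarith)
  have hpos : 0 < 2 / (ρ - 1) := div_pos two_pos (sub_pos.2 hρ1)
  have hr1 : (1 : ℝ) ≤ r := by exact_mod_cast hr
  have hρr : 18 * r ≤ ρ := by
    have h : (57600 * r ^ 2 : ℝ) ≤ G.edgeFinset.card := by exact_mod_cast hm3
    nlinarith
  have hx0 := hx ustar
  have h1 := sum_fW_le G hx heig ustar hU hW hρ2
  have h2 := surplus_le_sum_fW G hr hfree hx heig hρr hustar hU hW
  have h3 : ∑ w ∈ G.neighborFinset u ∩ (W \ Wstar), 4.5 * r / ρ * x ustar ≤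
      ∑ w ∈ W, fW G U W x ustar w := by
    refine le_trans (Finset.sum_le_sum fun w hw => ?_)
      (Finset.sum_le_sum_of_subset_of_nonneg
        (Finset.inter_subset_right.trans Finset.sdiff_subset)
        fun w _ _ => fW_nonneg G hx hustar U W w)
    simp only [Finset.mem_inter, SimpleGraph.mem_neighborFinset, Finset.mem_sdiff, hWstar,
      Finset.mem_filter, not_and, not_le] at hw
    obtain ⟨huw, hwW, hlt⟩ := hw
    have hd : (1 : ℝ) ≤ dIn G U w := by
      exact_mod_cast Finset.card_pos.2 ⟨u, by simp [huw.symm, hu]⟩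
    have hdx := mul_le_mul_of_nonneg_right hd (sub_nonneg.2 (hustar w))
    have := hlt hwW
    have hdW : 0 ≤ 1 / 2 * (dIn G W w : ℝ) * x ustar := by positivity
    unfold fW
    linarith
  rw [Finset.sum_const, nsmul_eq_mul] at h3
  change (dIn G (W \ Wstar) u : ℝ) * _ ≤ _ at h3
  have h4 := mul_pos hpos hx0
  have h5 : (dIn G (W \ Wstar) u : ℝ) * (4.5 * r / ρ) ≤ 2 :=
    le_of_mul_le_mul_right (by linarith) hx0
  rw [← mul_div_assoc, div_le_iff₀ (by linarith)] at h5
  have h6 : (dIn G (W \ Wstar) u : ℝ) * 1 ≤ dIn G (W \ Wstar) u * r :=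
    mul_le_mul_of_nonneg_left hr1 (Nat.cast_nonneg _)
  rw [le_div_iff₀ (by norm_num)]
  linarith

end PerronSetup
end

section
/- Under the Perron setup with the section-3 hypotheses (m ≥ (240r)² and ρ² ≥ m − 1 + 2/(ρ − 1)), one has Σ_{w ∈ W} f(w) < (1 + 1/24) x_{u*}. Consequently: the number of edges of G with both endpoints in W is at most 1; at most one vertex of W lies outside W*; and if w₀ ∈ W \ W*, then w₀ has degree 1 in G. -/
section PerronSetup

variable {V : Type*} [Fintype V] [DecidableEq V]

lemma cast_dIn (G : SimpleGraph V) [DecidableRel G.Adj] (S : Finset V) (w : V) :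
    (dIn G S w : ℝ) = ∑ v ∈ S, G.adjMatrix ℝ w v := by
  simp only [SimpleGraph.adjMatrix_apply, Finset.sum_boole, dIn]
  congr 2
  ext v
  simp [and_comm]

/-- The weight of `U` missed by a vertex `w`, times the weight of `w`, is controlled by `f(w)`. -/
lemma missed_weight_mul_le {ρ p y t a b : ℝ} (hp : 0 ≤ p) (hy : 0 ≤ y)
    (ht0 : 0 ≤ t) (ht1 : t ≤ 1) (h : ρ * t = p + y) (ha : p ≤ a) (hb : y ≤ b) :
    (ρ - p) * t ≤ 4 * (a * (1 - t) + 1 / 2 * b) := by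
  have h1 : p * (1 - t) ≤ a * (1 - t) := mul_le_mul_of_nonneg_right ha (by linarith)
  have h2 : 0 ≤ p * t := mul_nonneg hp ht0
  have h3 : 0 ≤ p * (1 - t) := mul_nonneg hp (by linarith)
  rcases le_total (ρ * t) (4 * p) with h4 | h4
  · have h5 := mul_le_mul_of_nonneg_right h4 (show 0 ≤ 1 - t by linarith)
    have h6 : y * t ≤ y := mul_le_of_le_one_right hy ht1
    have h7 : p * t = ρ * t * t - y * t := by rw [h]; ring
    nlinarith
  · nlinarith

/-- If `A` is a symmetric `[0,1]`-valued kernel on `U` with row sums at most `r`, then the weight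
of the `U`-pairs not both joined to `w` is at most `2r` times the weight of `U` missed by `w`. -/
lemma sum_pairs_missed_le {ι : Type*} (A : ι → ι → ℝ) (U : Finset ι) (r : ℝ) (x a : ι → ℝ)
    (hA0 : ∀ u v, 0 ≤ A u v) (hsymm : ∀ u v, A u v = A v u)
    (hx0 : ∀ v, 0 ≤ x v) (hx1 : ∀ v, x v ≤ 1) (ha1 : ∀ v, a v ≤ 1)
    (hrow : ∀ u ∈ U, ∑ v ∈ U, A u v ≤ r) :
    ∑ u ∈ U, ∑ v ∈ U, A u v * max 0 (x u + x v - 1) * (1 - a u * a v)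
      ≤ 2 * r * ∑ u ∈ U, (1 - a u) * x u := by
  have key : ∑ u ∈ U, ∑ v ∈ U, A u v * max 0 (x u + x v - 1) * (1 - a u)
      ≤ r * ∑ u ∈ U, (1 - a u) * x u := by
    rw [Finset.mul_sum]
    refine Finset.sum_le_sum fun u hu => ?_
    have hq : 0 ≤ (1 - a u) * x u := mul_nonneg (by linarith [ha1 u]) (hx0 u)
    calc ∑ v ∈ U, A u v * max 0 (x u + x v - 1) * (1 - a u)
        ≤ ∑ v ∈ U, A u v * ((1 - a u) * x u) := by
          refine Finset.sum_le_sum fun v _ => ?_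
          have hc : max 0 (x u + x v - 1) ≤ x u := max_le (hx0 u) (by linarith [hx1 v])
          have := mul_le_mul_of_nonneg_left hc
            (mul_nonneg (hA0 u v) (show 0 ≤ 1 - a u by linarith [ha1 u]))
          linarith
      _ = (∑ v ∈ U, A u v) * ((1 - a u) * x u) := by rw [Finset.sum_mul]
      _ ≤ r * ((1 - a u) * x u) := mul_le_mul_of_nonneg_right (hrow u hu) hq
  have key' : ∑ u ∈ U, ∑ v ∈ U, A u v * max 0 (x u + x v - 1) * (1 - a v)
      ≤ r * ∑ u ∈ U, (1 - a u) * x u := by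
    rw [Finset.sum_comm]
    refine le_of_eq_of_le ?_ key
    refine Finset.sum_congr rfl fun u _ => Finset.sum_congr rfl fun v _ => ?_
    rw [hsymm v u, add_comm (x v)]
  have hsum : ∑ u ∈ U, ∑ v ∈ U, A u v * max 0 (x u + x v - 1) * (1 - a u * a v)
      ≤ ∑ u ∈ U, ∑ v ∈ U, A u v * max 0 (x u + x v - 1) * (1 - a u)
        + ∑ u ∈ U, ∑ v ∈ U, A u v * max 0 (x u + x v - 1) * (1 - a v) := by
    rw [← Finset.sum_add_distrib]
    refine Finset.sum_le_sum fun u _ => ?_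
    rw [← Finset.sum_add_distrib]
    refine Finset.sum_le_sum fun v _ => ?_
    rw [← mul_add]
    refine mul_le_mul_of_nonneg_left ?_ (mul_nonneg (hA0 u v) (le_max_left _ _))
    nlinarith [ha1 u, ha1 v]
  linarith

lemma sum_univ_split_s12 (U W : Finset V) (z : V) (hz : z ∉ U) (hW : W = Finset.univ \ insert z U)
    (g : V → ℝ) : ∑ v, g v = g z + ∑ v ∈ U, g v + ∑ v ∈ W, g v := by
  rw [hW, ← Finset.sum_insert hz, add_comm]
  exact (Finset.sum_sdiff (Finset.subset_univ _)).symm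

/-- The bound on `∑ f(w)` for the Perron vector normalized by `x ustar = 1`. -/
lemma sum_fW_lt_of_normalized (G : SimpleGraph V) [DecidableRel G.Adj]
    (r : ℕ) (hr : 1 ≤ r)
    (hfree : ∀ u v, G.Adj u v → (G.neighborFinset u ∩ G.neighborFinset v).card ≤ r)
    (ρ : ℝ) (x : V → ℝ) (hx0 : ∀ v, 0 < x v) (hx1 : ∀ v, x v ≤ 1)
    (heig : ∀ u, ∑ v, G.adjMatrix ℝ u v * x v = ρ * x u)
    (z : V) (hz : x z = 1) (U W : Finset V) (hU : U = G.neighborFinset z)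
    (hW : W = Finset.univ \ insert z U)
    (hρ : 239 * r ≤ ρ) (hm : (G.edgeFinset.card : ℝ) - 1 ≤ ρ ^ 2) :
    ∑ w ∈ W, fW G U W x z w < 1 + 1 / 24 := by
  have hzU : z ∉ U := by simp [hU]
  have hr' : (1 : ℝ) ≤ r := by exact_mod_cast hr
  set A : V → V → ℝ := fun u v => G.adjMatrix ℝ u v with hA
  have hA0 : ∀ u v, 0 ≤ A u v := fun u v => by
    simp only [hA, SimpleGraph.adjMatrix_apply]; split_ifs <;> norm_num
  have hA1 : ∀ u v, A u v ≤ 1 := fun u v => by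
    simp only [hA, SimpleGraph.adjMatrix_apply]; split_ifs <;> norm_num
  have hsymm : ∀ u v, A u v = A v u := fun u v => by
    simp only [hA, SimpleGraph.adjMatrix_apply, G.adj_comm]
  have hAU : ∀ u ∈ U, A u z = 1 := fun u hu => by
    have : G.Adj z u := by simpa [hU] using hu
    simp [hA, this.symm]
  have hAW : ∀ w ∈ W, A w z = 0 := fun w hw => by
    have : ¬ G.Adj z w := by
      simp [hW, hU] at hw
      exact hw.2
    simp [hA, G.adj_comm w z, this]
  have hAz : A z z = 0 := by simp [hA]
  have hsplit := sum_univ_split_s12 U W z hzU hW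
  have hx0' : ∀ v, 0 ≤ x v := fun v => (hx0 v).le
  have hrow : ∀ u ∈ U, ∑ v ∈ U, A u v ≤ r := fun u hu => by
    have hadj : G.Adj u z := by
      have : G.Adj z u := by simpa [hU] using hu
      exact this.symm
    have h1 := hfree u z hadj
    rw [← hU] at h1
    have h2 := cast_dIn G U u
    simp only [hA]
    rw [← h2, dIn]
    exact_mod_cast h1
  have heU : ∀ u ∈ U, ρ * x u = 1 + ∑ v ∈ U, A u v * x v + ∑ w ∈ W, A u w * x w :=
    fun u hu => by
      rw [← heig u, hsplit]
      have := hAU u hu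
      simp only [hA] at this ⊢
      rw [this, hz]
      ring
  have heW : ∀ w ∈ W, ρ * x w = ∑ v ∈ U, A w v * x v + ∑ v ∈ W, A w v * x v :=
    fun w hw => by
      rw [← heig w, hsplit]
      have := hAW w hw
      simp only [hA] at this ⊢
      rw [this]
      ring
  have hez : ρ = ∑ u ∈ U, x u := by
    have h1 := heig z
    rw [hsplit, hz, mul_one, mul_one] at h1
    rw [← h1]
    have h2 : ∑ v ∈ W, A z v * x v = 0 := Finset.sum_eq_zero fun w hw => by
      rw [hsymm, hAW w hw, zero_mul]
    have h3 : ∑ v ∈ U, A z v * x v = ∑ u ∈ U, x u := Finset.sum_congr rfl fun u hu => by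
      rw [hsymm, hAU u hu, one_mul]
    simp only [hA] at h2 h3 hAz
    rw [h2, h3, hAz]
    ring
  set F := ∑ w ∈ W, fW G U W x z w with hF
  have hfW : ∀ w, fW G U W x z w
      = (∑ u ∈ U, A w u) * (1 - x w) + 1 / 2 * ∑ v ∈ W, A w v := fun w => by
    rw [fW, cast_dIn, cast_dIn, hz, mul_one]
  have hf : ∀ w ∈ W, (∑ u ∈ U, (1 - A w u) * x u) * x w ≤ 4 * fW G U W x z w :=
    fun w hw => by
      have h1 : ∑ u ∈ U, (1 - A w u) * x u = ρ - ∑ u ∈ U, A w u * x u := by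
        rw [hez, ← Finset.sum_sub_distrib]
        exact Finset.sum_congr rfl fun u _ => by ring
      rw [h1, hfW]
      exact missed_weight_mul_le
        (Finset.sum_nonneg fun v _ => mul_nonneg (hA0 w v) (hx0' v))
        (Finset.sum_nonneg fun v _ => mul_nonneg (hA0 w v) (hx0' v))
        (hx0' w) (hx1 w) (heW w hw)
        (Finset.sum_le_sum fun v _ => mul_le_of_le_one_right (hA0 w v) (hx1 v))
        (Finset.sum_le_sum fun v _ => mul_le_of_le_one_right (hA0 w v) (hx1 v))
  set C := ∑ u ∈ U, ∑ v ∈ U, A u v * max 0 (x u + x v - 1) with hC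
  have hC0 : 0 ≤ C := Finset.sum_nonneg fun u _ => Finset.sum_nonneg fun v _ =>
    mul_nonneg (hA0 u v) (le_max_left _ _)
  have hpair : ∀ u ∈ U, ∀ v ∈ U,
      A u v * max 0 (x u + x v - 1) * (233 * r)
        ≤ ∑ w ∈ W, A u v * max 0 (x u + x v - 1) * (1 - A w u * A w v) * x w := by
    intro u hu v hv
    have hrhs : ∑ w ∈ W, A u v * max 0 (x u + x v - 1) * (1 - A w u * A w v) * x w
        = A u v * max 0 (x u + x v - 1) * ∑ w ∈ W, (1 - A w u * A w v) * x w := by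
      rw [Finset.mul_sum]
      exact Finset.sum_congr rfl fun w _ => by ring
    rw [hrhs]
    by_cases hadj : G.Adj u v
    swap
    · simp [hA, hadj]
    rcases le_or_gt (x u + x v - 1) 0 with hneg | hpos
    · rw [max_eq_left hneg]; simp
    refine mul_le_mul_of_nonneg_left ?_ (mul_nonneg (hA0 u v) (le_max_left _ _))
    have hcomm : ∑ w ∈ W, A w u * A w v ≤ r := by
      have h1 : ∑ w ∈ W, A w u * A w v
          = ((W.filter fun w => G.Adj u w ∧ G.Adj v w).card : ℝ) := by
        rw [← Finset.sum_boole]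
        refine Finset.sum_congr rfl fun w _ => ?_
        simp only [hA, SimpleGraph.adjMatrix_apply, G.adj_comm w]
        by_cases h1 : G.Adj u w <;> by_cases h2 : G.Adj v w <;> simp [h1, h2]
      rw [h1]
      have h2 : (W.filter fun w => G.Adj u w ∧ G.Adj v w)
          ⊆ G.neighborFinset u ∩ G.neighborFinset v := fun w hw => by
        simpa using (Finset.mem_filter.1 hw).2
      exact_mod_cast (Finset.card_le_card h2).trans (hfree u v hadj)
    have hUb : ∀ u ∈ U, ∑ v ∈ U, A u v * x v ≤ r := fun u hu =>
      (Finset.sum_le_sum fun v _ => mul_le_of_le_one_right (hA0 u v) (hx1 v)).trans (hrow u hu)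
    have hWb : ∑ w ∈ W, A u w * x w + ∑ w ∈ W, A v w * x w
        ≤ ∑ w ∈ W, (1 - A w u * A w v) * x w + 2 * ∑ w ∈ W, A w u * A w v := by
      rw [Finset.mul_sum, ← Finset.sum_add_distrib, ← Finset.sum_add_distrib]
      refine Finset.sum_le_sum fun w _ => ?_
      rw [hsymm u w, hsymm v w]
      have h1 : 0 ≤ (1 - A w u) * (1 - A w v) * x w :=
        mul_nonneg (mul_nonneg (by linarith [hA1 w u]) (by linarith [hA1 w v])) (hx0' w)
      have h2 : A w u * A w v * x w ≤ A w u * A w v :=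
        mul_le_of_le_one_right (mul_nonneg (hA0 w u) (hA0 w v)) (hx1 w)
      linarith
    have h1 := heU u hu
    have h2 := heU v hv
    have h3 := hUb u hu
    have h4 := hUb v hv
    have h5 : ρ * 1 ≤ ρ * (x u + x v) :=
      mul_le_mul_of_nonneg_left (by linarith) (by linarith)
    linarith
  have hCF : C * (233 * r) ≤ 8 * r * F := by
    calc C * (233 * r)
        = ∑ u ∈ U, ∑ v ∈ U, A u v * max 0 (x u + x v - 1) * (233 * r) := by
          rw [hC, Finset.sum_mul]
          exact Finset.sum_congr rfl fun u _ => by rw [Finset.sum_mul]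
      _ ≤ ∑ u ∈ U, ∑ v ∈ U, ∑ w ∈ W,
            A u v * max 0 (x u + x v - 1) * (1 - A w u * A w v) * x w :=
          Finset.sum_le_sum fun u hu => Finset.sum_le_sum fun v hv => hpair u hu v hv
      _ = ∑ w ∈ W, (∑ u ∈ U, ∑ v ∈ U,
            A u v * max 0 (x u + x v - 1) * (1 - A w u * A w v)) * x w := by
          rw [Finset.sum_congr rfl fun u _ => Finset.sum_comm, Finset.sum_comm]
          refine Finset.sum_congr rfl fun w _ => ?_
          rw [Finset.sum_mul]
          exact Finset.sum_congr rfl fun u _ => by rw [Finset.sum_mul]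
      _ ≤ ∑ w ∈ W, 8 * r * fW G U W x z w := by
          refine Finset.sum_le_sum fun w hw => ?_
          have h1 := sum_pairs_missed_le A U r x (A w) hA0 hsymm hx0' hx1 (hA1 w) hrow
          have h2 := mul_le_mul_of_nonneg_right h1 (hx0' w)
          have h3 := mul_le_mul_of_nonneg_left (hf w hw) (show (0 : ℝ) ≤ 2 * r by linarith)
          linarith
      _ = 8 * r * F := by rw [hF, Finset.mul_sum]
  have hC29 : 29 * C ≤ F := by
    have h1 : (r : ℝ) * (233 * C) ≤ r * (8 * F) := by linarith
    have h2 := le_of_mul_le_mul_left h1 (by linarith)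
    linarith
  have hident : 2 * F = 2 * (G.edgeFinset.card - ρ ^ 2)
      + ∑ u ∈ U, ∑ v ∈ U, A u v * (x u + x v - 1) := by
    have hdeg : ∀ v, (G.degree v : ℝ) = A v z + ∑ u ∈ U, A v u + ∑ w ∈ W, A v w := fun v => by
      rw [← hsplit (A v)]
      simp [hA, SimpleGraph.adjMatrix_apply]
      rw [← SimpleGraph.card_neighborFinset_eq_degree]
      congr 1
      ext; simp
    have hdz : (G.degree z : ℝ) = U.card := by
      rw [hU, SimpleGraph.card_neighborFinset_eq_degree]
    have h2m : 2 * (G.edgeFinset.card : ℝ) = 2 * U.card + ∑ u ∈ U, ∑ v ∈ U, A u v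
        + ∑ u ∈ U, ∑ w ∈ W, A u w + ∑ w ∈ W, ∑ u ∈ U, A w u + ∑ w ∈ W, ∑ v ∈ W, A w v := by
      have h1 : ∑ v, (G.degree v : ℝ) = 2 * G.edgeFinset.card := by
        exact_mod_cast G.sum_degrees_eq_twice_card_edges
      rw [← h1, hsplit, hdz, Finset.sum_congr rfl fun v _ => hdeg v,
        Finset.sum_congr (s₁ := W) rfl fun v _ => hdeg v]
      simp only [Finset.sum_add_distrib]
      rw [Finset.sum_congr rfl hAU, Finset.sum_congr rfl hAW]
      simp
      ring
    have hρ2 : ρ ^ 2 = U.card + ∑ u ∈ U, ∑ v ∈ U, A u v * x v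
        + ∑ u ∈ U, ∑ w ∈ W, A u w * x w := by
      have h1 : ρ ^ 2 = ∑ u ∈ U, ρ * x u := by rw [← Finset.mul_sum, ← hez, sq]
      rw [h1, Finset.sum_congr rfl heU]
      simp only [Finset.sum_add_distrib]
      simp
    have hcross : ∑ u ∈ U, ∑ w ∈ W, A u w = ∑ w ∈ W, ∑ u ∈ U, A w u := by
      rw [Finset.sum_comm]
      exact Finset.sum_congr rfl fun w _ => Finset.sum_congr rfl fun u _ => hsymm u w
    have hcross' : ∑ u ∈ U, ∑ w ∈ W, A u w * x w = ∑ w ∈ W, (∑ u ∈ U, A w u) * x w := by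
      rw [Finset.sum_comm]
      refine Finset.sum_congr rfl fun w _ => ?_
      rw [Finset.sum_mul]
      exact Finset.sum_congr rfl fun u _ => by rw [hsymm u w]
    have hswap : ∑ u ∈ U, ∑ v ∈ U, A u v * x u = ∑ u ∈ U, ∑ v ∈ U, A u v * x v := by
      rw [Finset.sum_comm]
      exact Finset.sum_congr rfl fun w _ => Finset.sum_congr rfl fun u _ => by rw [hsymm u w]
    have hF' : F = ∑ w ∈ W, ∑ u ∈ U, A w u - ∑ w ∈ W, (∑ u ∈ U, A w u) * x w
        + 1 / 2 * ∑ w ∈ W, ∑ v ∈ W, A w v := by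
      rw [hF, Finset.sum_congr rfl fun w _ => hfW w, Finset.mul_sum, ← Finset.sum_sub_distrib,
        ← Finset.sum_add_distrib]
      exact Finset.sum_congr rfl fun w _ => by ring
    have hlast : ∑ u ∈ U, ∑ v ∈ U, A u v * (x u + x v - 1)
        = ∑ u ∈ U, ∑ v ∈ U, A u v * x u + ∑ u ∈ U, ∑ v ∈ U, A u v * x v
          - ∑ u ∈ U, ∑ v ∈ U, A u v := by
      simp only [← Finset.sum_add_distrib, ← Finset.sum_sub_distrib]
      exact Finset.sum_congr rfl fun w _ => Finset.sum_congr rfl fun u _ => by ring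
    rw [hF', hlast]
    linarith
  have hle : ∑ u ∈ U, ∑ v ∈ U, A u v * (x u + x v - 1) ≤ C :=
    Finset.sum_le_sum fun u _ => Finset.sum_le_sum fun v _ =>
      mul_le_mul_of_nonneg_left (le_max_right _ _) (hA0 u v)
  linarith

/-- A vertex of weight `t` below the threshold with `n` neighbors in `U` has large deficit. -/
lemma deficit_lower_bound {ρ r t n b k : ℝ} (hρ : 239 ≤ ρ) (hr : 1 ≤ r) (hb : b ≤ 1)
    (ht : t < 1 - 4.5 * r / ρ) (h : ρ * t ≤ n + b) (hk1 : 1 ≤ k) (hk : k ≤ 2) (hn : k ≤ n) :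
    k * 0.98 ≤ n * (1 - t) := by
  have hρ0 : 0 < ρ := by linarith
  rcases le_or_gt (2 * n) ρ with hc | hc
  · have h1 : 0 ≤ (n - k) * (ρ - n - k - 1) := mul_nonneg (by linarith) (by linarith)
    have h2 : n * (ρ * t) ≤ n * (n + 1) :=
      mul_le_mul_of_nonneg_left (by linarith) (by linarith)
    have h3 : ρ * (k * 0.98) ≤ ρ * (n * (1 - t)) := by nlinarith
    exact le_of_mul_le_mul_left h3 hρ0
  · have h1 : 4.5 * r / ρ ≤ 1 - t := by linarith
    have h2 : 4.5 * r ≤ (1 - t) * ρ := (div_le_iff₀ hρ0).1 h1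
    have h3 : 0 ≤ (1 - t) := le_trans (by positivity) h1
    have h4 : (1 - t) * ρ ≤ (1 - t) * (2 * n) := mul_le_mul_of_nonneg_left hc.le h3
    linarith

/-- The consequences of the bound on `∑ f(w)` for the Perron vector normalized by
`x ustar = 1`. -/
lemma structure_of_sum_fW_lt (G : SimpleGraph V) [DecidableRel G.Adj]
    (r : ℕ) (hr : 1 ≤ r) (ρ : ℝ) (x : V → ℝ) (hx0 : ∀ v, 0 < x v) (hx1 : ∀ v, x v ≤ 1)
    (heig : ∀ u, ∑ v, G.adjMatrix ℝ u v * x v = ρ * x u)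
    (z : V) (hz : x z = 1) (U W Wstar : Finset V) (hU : U = G.neighborFinset z)
    (hW : W = Finset.univ \ insert z U)
    (hWstar : Wstar = W.filter (fun w => 1 - 4.5 * r / ρ ≤ x w))
    (hρ : 239 ≤ ρ) (hF : ∑ w ∈ W, fW G U W x z w < 1 + 1 / 24) :
    ((G.edgeFinset.filter (fun e => e ∈ W.sym2)).card ≤ 1) ∧
    ((W \ Wstar).card ≤ 1) ∧
    (∀ w₀ ∈ W \ Wstar, G.degree w₀ = 1) := by
  have hr' : (1 : ℝ) ≤ r := by exact_mod_cast hr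
  have hfW : ∀ w, fW G U W x z w = (dIn G U w : ℝ) * (1 - x w) + 1 / 2 * dIn G W w := fun w => by
    rw [fW, hz, mul_one]
  have hfD : ∀ w, 1 / 2 * (dIn G W w : ℝ) ≤ fW G U W x z w := fun w => by
    rw [hfW]
    have : 0 ≤ (dIn G U w : ℝ) * (1 - x w) := mul_nonneg (by positivity) (by linarith [hx1 w])
    linarith
  have hf0 : ∀ w, 0 ≤ fW G U W x z w := fun w => le_trans (by positivity) (hfD w)
  have hsub : ∀ S ⊆ W, ∑ w ∈ S, fW G U W x z w < 1 + 1 / 24 := fun S hS =>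
    (Finset.sum_le_sum_of_subset_of_nonneg hS fun w _ _ => hf0 w).trans_lt hF
  have hDsub : ∀ S ⊆ W, ∑ w ∈ S, dIn G W w ≤ 2 := fun S hS => by
    have h1 : ∑ w ∈ S, (dIn G W w : ℝ) ≤ 2 * ∑ w ∈ S, fW G U W x z w := by
      rw [Finset.mul_sum]
      exact Finset.sum_le_sum fun w _ => by linarith [hfD w]
    have h2 : ((∑ w ∈ S, dIn G W w : ℕ) : ℝ) < (3 : ℕ) := by
      push_cast
      linarith [hsub S hS]
    have h3 := Nat.cast_lt.1 h2
    omega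
  have hDpos : ∀ a, ∀ b ∈ W, G.Adj a b → 1 ≤ dIn G W a := fun a b hb hab =>
    Finset.card_pos.2 ⟨b, by simp [hab, hb]⟩
  have hthird : ∀ a ∈ W, ∀ b ∈ W, G.Adj a b → ∀ c ∈ W, 1 ≤ dIn G W c → c = a ∨ c = b := by
    intro a ha b hb hab c hc hDc
    by_contra! hne
    have h1 := hDsub {c, a, b} (by
      intro v hv
      simp only [Finset.mem_insert, Finset.mem_singleton] at hv
      rcases hv with rfl | rfl | rfl <;> assumption)
    rw [Finset.sum_insert (by simp [hne.1, hne.2]), Finset.sum_pair hab.ne] at h1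
    have h2 := hDpos a b hb hab
    have h3 := hDpos b a ha hab.symm
    omega
  have hdeg : ∀ w ∈ W, G.degree w = dIn G U w + dIn G W w := fun w hw => by
    have hwz : ¬ G.Adj w z := by
      rw [hW, hU] at hw
      simp at hw
      exact fun h => hw.2 h.symm
    rw [dIn, dIn, ← Finset.card_union_of_disjoint, ← SimpleGraph.card_neighborFinset_eq_degree]
    · congr 1
      ext v
      by_cases hv : v = z
      · subst hv
        simp [hwz]
      · simp [hW, hv]
        tauto
    · rw [Finset.disjoint_left]
      intro v hv hv'
      rw [hW] at hv'
      simp at hv hv'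
      exact hv'.2.2 hv.2
  have heig' : ∀ w, ρ * x w = ∑ v ∈ G.neighborFinset w, x v := fun w => by
    rw [← heig w]
    simp only [SimpleGraph.adjMatrix_apply, ite_mul, one_mul, zero_mul]
    rw [← Finset.sum_filter]
    congr 1
    ext; simp
  have hle : ∀ w, ρ * x w ≤ G.degree w := fun w => by
    rw [heig' w, ← SimpleGraph.card_neighborFinset_eq_degree, Finset.card_eq_sum_ones]
    push_cast
    exact Finset.sum_le_sum fun v _ => hx1 v
  have hdegpos : ∀ w, 1 ≤ G.degree w := fun w => by
    have h1 : (0 : ℝ) < G.degree w := lt_of_lt_of_le (mul_pos (by linarith) (hx0 w)) (hle w)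
    exact_mod_cast h1
  have hexists : ∀ w, 1 ≤ dIn G W w → ∃ v ∈ W, G.Adj w v := fun w hw => by
    obtain ⟨v, hv⟩ := Finset.card_pos.1 hw
    simp at hv
    exact ⟨v, hv.2, hv.1⟩
  have hclass : ∀ w ∈ W \ Wstar, (dIn G W w = 0 ∧ dIn G U w = 1 ∧ 0.98 ≤ fW G U W x z w) ∨
      (dIn G W w = 1 ∧ dIn G U w = 0) := by
    intro w hw
    have hwW : w ∈ W := (Finset.mem_sdiff.1 hw).1
    have hxw : x w < 1 - 4.5 * r / ρ := by
      rw [hWstar] at hw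
      simp only [Finset.mem_sdiff, Finset.mem_filter, not_and, not_le] at hw
      exact hw.2 hwW
    have hlew := hle w
    rw [hdeg w hwW] at hlew
    push_cast at hlew
    have hone := hsub {w} (by simpa using hwW)
    rw [Finset.sum_singleton] at hone
    rcases Nat.eq_zero_or_pos (dIn G W w) with hD | hD
    · left
      have hd := hdegpos w
      rw [hdeg w hwW, hD, add_zero] at hd
      rw [hD] at hlew
      rw [hfW, hD] at hone ⊢
      have hd' : (1 : ℝ) ≤ dIn G U w := by exact_mod_cast hd
      have h1 := deficit_lower_bound (k := 1) hρ hr' (by norm_num) hxw hlew le_rfl (by norm_num) hd'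
      refine ⟨rfl, ?_, by norm_num at h1 ⊢; linarith⟩
      by_contra hne
      have hd2 : 2 ≤ dIn G U w := by omega
      have hd2' : (2 : ℝ) ≤ dIn G U w := by exact_mod_cast hd2
      have h2 := deficit_lower_bound (k := 2) hρ hr' (by norm_num) hxw hlew (by norm_num) le_rfl hd2'
      norm_num at h2 hone
      linarith
    · right
      obtain ⟨v, hv, hwv⟩ := hexists w hD
      have h1 := hDsub {w, v} (by
        intro a ha
        simp only [Finset.mem_insert, Finset.mem_singleton] at ha
        rcases ha with rfl | rfl <;> assumption)
      rw [Finset.sum_pair hwv.ne] at h1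
      have h2 := hDpos v w hwW hwv.symm
      have hD1 : dIn G W w = 1 := by omega
      refine ⟨hD1, ?_⟩
      by_contra hne
      have hd' : (1 : ℝ) ≤ dIn G U w := by exact_mod_cast Nat.one_le_iff_ne_zero.2 hne
      rw [hD1] at hlew
      have h3 := deficit_lower_bound (k := 1) hρ hr' (by norm_num) hxw hlew le_rfl (by norm_num) hd'
      have h4 := hsub {w, v} (by
        intro a ha
        simp only [Finset.mem_insert, Finset.mem_singleton] at ha
        rcases ha with rfl | rfl <;> assumption)
      rw [Finset.sum_pair hwv.ne, hfW w, hD1] at h4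
      have h5 := hfD v
      have h6 : (1 : ℝ) ≤ dIn G W v := by exact_mod_cast h2
      norm_num at h3 h4
      linarith
  refine ⟨?_, ?_, ?_⟩
  · rw [Finset.card_le_one]
    intro e he e' he'
    induction e with | _ a b => ?_
    induction e' with | _ c d => ?_
    simp only [Finset.mem_filter, SimpleGraph.mem_edgeFinset, SimpleGraph.mem_edgeSet,
      Finset.mk_mem_sym2_iff] at he he'
    obtain ⟨hab, ha, hb⟩ := he
    obtain ⟨hcd, hc, hd⟩ := he'
    have h1 := hthird a ha b hb hab c hc (hDpos c d hd hcd)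
    have h2 := hthird a ha b hb hab d hd (hDpos d c hc hcd.symm)
    have h3 := hcd.ne
    rcases h1 with rfl | rfl <;> rcases h2 with rfl | rfl <;> simp_all [Sym2.eq_swap]
  · have hmixed : ∀ a ∈ W, ∀ b ∈ W, dIn G W a = 1 → dIn G W b = 0 →
        0.98 ≤ fW G U W x z b → False := by
      intro a ha b hb hDa hDb hfb
      obtain ⟨c, hc, hac⟩ := hexists a hDa.ge
      have hDc := hDpos c a ha hac.symm
      have hba : b ≠ a := by rintro rfl; omega
      have hbc : b ≠ c := by rintro rfl; omega
      have h1 := hsub {b, a, c} (by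
        intro v hv
        simp only [Finset.mem_insert, Finset.mem_singleton] at hv
        rcases hv with rfl | rfl | rfl <;> assumption)
      rw [Finset.sum_insert (by simp [hba, hbc]), Finset.sum_pair hac.ne] at h1
      have h2 := hfD a
      have h3 := hfD c
      have h4 : (1 : ℝ) ≤ dIn G W c := by exact_mod_cast hDc
      rw [hDa] at h2
      norm_num at h1 h2 hfb
      linarith
    rw [Finset.card_le_one]
    intro a ha b hb
    have haW := (Finset.mem_sdiff.1 ha).1
    have hbW := (Finset.mem_sdiff.1 hb).1
    by_contra hne
    rcases hclass a ha with ⟨hDa, -, hfa⟩ | ⟨hDa, hda⟩ <;>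
      rcases hclass b hb with ⟨hDb, -, hfb⟩ | ⟨hDb, hdb⟩
    · have h1 := hsub {a, b} (by
        intro v hv
        simp only [Finset.mem_insert, Finset.mem_singleton] at hv
        rcases hv with rfl | rfl <;> assumption)
      rw [Finset.sum_pair hne] at h1
      norm_num at h1 hfa hfb
      linarith
    · exact hmixed b hbW a haW hDb hDa hfa
    · exact hmixed a haW b hbW hDa hDb hfb
    · obtain ⟨c, hc, hac⟩ := hexists a hDa.ge
      have hbc : b = c := (hthird a haW c hc hac b hbW hDb.ge).resolve_left (Ne.symm hne)
      subst hbc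
      have hleaf : ∀ u ∈ W, ∀ v, G.Adj u v → dIn G W u = 1 → dIn G U u = 0 →
          ρ * x u = x v := by
        intro u hu v huv h1 h2
        have h3 := hdeg u hu
        rw [h1, h2, ← SimpleGraph.card_neighborFinset_eq_degree] at h3
        obtain ⟨y, hy⟩ := Finset.card_eq_one.1 h3
        have hv : v ∈ G.neighborFinset u := by simpa using huv
        rw [hy, Finset.mem_singleton] at hv
        rw [heig' u, hy, Finset.sum_singleton, hv]
      have h1 := hleaf a haW b hac hDa hda
      have h2 := hleaf b hbW a hac.symm hDb hdb
      have h3 := hx0 a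
      have h4 := hx0 b
      nlinarith
  · intro w hw
    rw [hdeg w (Finset.mem_sdiff.1 hw).1]
    rcases hclass w hw with ⟨h1, h2, -⟩ | ⟨h1, h2⟩ <;> omega

/-- Under the section-3 hypotheses, `Σ_{w ∈ W} f(w) < (1 + 1/24) x_{u*}`; consequently `G` has at most one edge inside `W`, at most one vertex of `W` lies outside `W*`, and any vertex of `W \\ W*` has degree `1` in `G`. -/
theorem claim_3_2
    {V : Type*} [Fintype V] [DecidableEq V]
    (G : SimpleGraph V) [DecidableRel G.Adj] (hconn : G.Connected)
    (r : ℕ) (hr : 1 ≤ r)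
    (hfree : ∀ u v, G.Adj u v → (G.neighborFinset u ∩ G.neighborFinset v).card ≤ r)
    (hm : 1 ≤ G.edgeFinset.card)
    (ρ : ℝ) (x : V → ℝ) (hx : ∀ v, 0 < x v)
    (heig : (G.adjMatrix ℝ).mulVec x = ρ • x)
    (ustar : V) (hustar : ∀ v, x v ≤ x ustar)
    (U W Wstar : Finset V)
    (hU : U = G.neighborFinset ustar)
    (hW : W = Finset.univ \ insert ustar U)
    (hWstar : Wstar = W.filter (fun w => (1 - 4.5 * r / ρ) * x ustar ≤ x w))
    (hm2 : (240 * r) ^ 2 ≤ G.edgeFinset.card)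
    (hρ2 : (G.edgeFinset.card : ℝ) - 1 + 2 / (ρ - 1) ≤ ρ ^ 2)
    :
    (∑ w ∈ W, fW G U W x ustar w < (1 + 1 / 24) * x ustar) ∧
    ((G.edgeFinset.filter (fun e => e ∈ W.sym2)).card ≤ 1) ∧
    ((W \ Wstar).card ≤ 1) ∧
    (∀ w₀ ∈ W \ Wstar, G.degree w₀ = 1) := by
  have hz0 := hx ustar
  have heig' : ∀ u, ∑ v, G.adjMatrix ℝ u v * x v = ρ * x u := fun u => by
    simpa [Matrix.mulVec, dotProduct] using congrFun heig u
  have hr' : (1 : ℝ) ≤ r := by exact_mod_cast hr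
  have hm2' : (240 * (r : ℝ)) ^ 2 ≤ G.edgeFinset.card := by exact_mod_cast hm2
  have hnbr : ∀ u v, G.Adj u v → x v ≤ ρ * x u := fun u v huv => by
    rw [← heig' u]
    have h1 : x v = G.adjMatrix ℝ u v * x v := by simp [huv]
    rw [h1]
    refine Finset.single_le_sum (f := fun v => G.adjMatrix ℝ u v * x v) (fun w _ => ?_)
      (Finset.mem_univ v)
    refine mul_nonneg ?_ (hx w).le
    rw [SimpleGraph.adjMatrix_apply]
    split_ifs <;> norm_num
  have hρ1 : 1 ≤ ρ := by
    obtain ⟨e, he⟩ := Finset.card_pos.1 hm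
    induction e with | _ u v => ?_
    have huv : G.Adj u v := by simpa using he
    have h1 := hnbr u v huv
    have h2 := hnbr v u huv.symm
    by_contra! hlt
    nlinarith [hx u, hx v]
  have hm3 : (G.edgeFinset.card : ℝ) - 1 ≤ ρ ^ 2 := by
    have : 0 ≤ 2 / (ρ - 1) := div_nonneg (by norm_num) (by linarith)
    linarith
  have hρ : 239 * (r : ℝ) ≤ ρ := by
    refine le_of_sq_le_sq ?_ (by linarith)
    nlinarith
  have hy0 : ∀ v, 0 < x v / x ustar := fun v => div_pos (hx v) hz0
  have hy1 : ∀ v, x v / x ustar ≤ 1 := fun v => (div_le_one hz0).2 (hustar v)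
  have hyeig : ∀ u, ∑ v, G.adjMatrix ℝ u v * (x v / x ustar) = ρ * (x u / x ustar) := fun u => by
    simp only [← mul_div_assoc, ← Finset.sum_div, heig']
  have hyz : x ustar / x ustar = 1 := div_self hz0.ne'
  have hF := sum_fW_lt_of_normalized G r hr hfree ρ (fun v => x v / x ustar) hy0 hy1 hyeig ustar
    hyz U W hU hW hρ hm3
  refine ⟨?_, structure_of_sum_fW_lt G r hr ρ (fun v => x v / x ustar) hy0 hy1 hyeig ustar hyz
    U W Wstar hU hW ?_ (by linarith) hF⟩
  · have h1 : ∑ w ∈ W, fW G U W x ustar w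
        = (∑ w ∈ W, fW G U W (fun v => x v / x ustar) ustar w) * x ustar := by
      rw [Finset.sum_mul]
      refine Finset.sum_congr rfl fun w _ => ?_
      simp only [fW]
      field_simp
    rw [h1]
    exact mul_lt_mul_of_pos_right hF hz0
  · rw [hWstar]
    refine Finset.filter_congr fun w _ => ?_
    rw [le_div_iff₀ hz0]

end PerronSetup
end

section
/- Under the Perron setup with the section-3 hypotheses (m ≥ (240r)² and ρ² ≥ m − 1 + 2/(ρ − 1)), if G has at least one edge with both endpoints in U, then x_u < (1/3) x_{u*} for every vertex u ∈ U. -/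
section PerronSetup

variable {V : Type*} [Fintype V] [DecidableEq V]

/-- The number (or total weight) of neighbours of `v` in `S`, for a weighted adjacency `a`. -/
def rowSum {V : Type*} (a : V → V → ℝ) (S : Finset V) (v : V) : ℝ := ∑ u ∈ S, a v u

/-- Exchanging the order of summation in a symmetric bilinear sum. -/
lemma sum_sum_mul_eq_sum_rowSum_mul {V : Type*} {a : V → V → ℝ} (hsymm : ∀ u v, a u v = a v u)
    (A B : Finset V) (g : V → ℝ) :
    ∑ u ∈ A, ∑ w ∈ B, a u w * g w = ∑ w ∈ B, rowSum a A w * g w := by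
  rw [Finset.sum_comm]
  refine Finset.sum_congr rfl fun w _ => ?_
  rw [rowSum, Finset.sum_mul]
  exact Finset.sum_congr rfl fun u _ => by rw [hsymm]

/-- The local data around a vertex of maximum Perron weight, normalised to `1`: `U` is its
neighbourhood, and the remaining vertices are split into `S` (weight near `1`) and `T`. -/
structure PerronSplit {V : Type*} (a : V → V → ℝ) (z : V → ℝ) (U S T : Finset V)
    (r ρ : ℝ) : Prop where
  symm : ∀ u v, a u v = a v u
  zero_or_one : ∀ u v, a u v = 0 ∨ a u v = 1
  one_le_r : 1 ≤ r
  le_rho : 239 * r ≤ ρ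
  pos : ∀ v, 0 < z v
  le_one : ∀ v, z v ≤ 1
  sum_U : ∑ u ∈ U, z u = ρ
  eig_U : ∀ u ∈ U, ρ * z u =
    1 + ∑ v ∈ U, a u v * z v + ∑ w ∈ S, a u w * z w + ∑ w ∈ T, a u w * z w
  eig_S : ∀ w ∈ S, ρ * z w =
    ∑ v ∈ U, a w v * z v + ∑ v ∈ S, a w v * z v + ∑ v ∈ T, a w v * z v
  deg_le : ∀ u ∈ U, rowSum a U u ≤ r
  common_le : ∀ u ∈ U, ∀ v ∈ U, a u v = 1 → ∑ w ∈ S, a u w * a v w ≤ r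
  large : ∀ w ∈ S, 1 - 4.5 * r / ρ ≤ z w
  small : ∀ w ∈ T, z w ≤ 1 - 4.5 * r / ρ
  exists_edge : ∃ u ∈ U, ∃ v ∈ U, a u v = 1
  main_le : ∑ w ∈ S, (rowSum a U w * (1 - z w) + (rowSum a S w + rowSum a T w) / 2)
    + ∑ w ∈ T, (rowSum a U w * (1 - z w) + (rowSum a S w + rowSum a T w) / 2)
    + (∑ u ∈ U, rowSum a U u) / 2 ≤ 1 + ∑ u ∈ U, rowSum a U u * z u

namespace PerronSplit

variable {V : Type*} {a : V → V → ℝ} {z : V → ℝ} {U S T : Finset V} {r ρ : ℝ}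

lemma nonneg (h : PerronSplit a z U S T r ρ) (u v : V) : 0 ≤ a u v := by
  rcases h.zero_or_one u v with e | e <;> simp [e]

lemma entry_le_one (h : PerronSplit a z U S T r ρ) (u v : V) : a u v ≤ 1 := by
  rcases h.zero_or_one u v with e | e <;> simp [e]

lemma rowSum_nonneg (h : PerronSplit a z U S T r ρ) (A : Finset V) (v : V) :
    0 ≤ rowSum a A v :=
  Finset.sum_nonneg fun _ _ => h.nonneg _ _

lemma sum_mul_le_rowSum (h : PerronSplit a z U S T r ρ) (A : Finset V) (v : V) :
    ∑ w ∈ A, a v w * z w ≤ rowSum a A v :=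
  Finset.sum_le_sum fun w _ => mul_le_of_le_one_right (h.nonneg _ _) (h.le_one w)

lemma rowSum_le_card (h : PerronSplit a z U S T r ρ) (A : Finset V) (v : V) :
    rowSum a A v ≤ A.card := by
  simpa [rowSum] using Finset.sum_le_sum fun w (_ : w ∈ A) => h.entry_le_one v w

lemma one_le_rho (h : PerronSplit a z U S T r ρ) : 239 ≤ ρ := by
  linarith [h.one_le_r, h.le_rho]

/-- Half of the degree sum inside `U` is at least one. -/
lemma two_le_sum_rowSum (h : PerronSplit a z U S T r ρ) (hloop : ∀ v, a v v = 0) :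
    2 ≤ ∑ u ∈ U, rowSum a U u := by
  classical
  obtain ⟨u, hu, v, hv, huv⟩ := h.exists_edge
  have hne : u ≠ v := by rintro rfl; simp [hloop] at huv
  have h1 : ∀ x ∈ U, ∀ y ∈ U, a x y = 1 → 1 ≤ rowSum a U x := fun x _ y hy hxy => by
    rw [← hxy]
    exact Finset.single_le_sum (f := fun y => a x y) (fun _ _ => h.nonneg _ _) hy
  have h2 : ∑ x ∈ {u, v}, rowSum a U x ≤ ∑ u ∈ U, rowSum a U u :=
    Finset.sum_le_sum_of_subset_of_nonneg (by simp [Finset.insert_subset_iff, hu, hv])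
      fun _ _ _ => h.rowSum_nonneg _ _
  rw [Finset.sum_pair hne] at h2
  linarith [h1 u hu v hv huv, h1 v hv u hu (h.symm u v ▸ huv)]

/-- Two adjacent vertices of `U` have few common neighbours in `S`. -/
lemma rowSum_add_rowSum_le (h : PerronSplit a z U S T r ρ) {u v : V} (hu : u ∈ U) (hv : v ∈ U)
    (huv : a u v = 1) : rowSum a S u + rowSum a S v ≤ S.card + r := by
  have h1 : rowSum a S u + rowSum a S v ≤ ∑ w ∈ S, (1 + a u w * a v w) := by
    rw [rowSum, rowSum, ← Finset.sum_add_distrib]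
    refine Finset.sum_le_sum fun w _ => ?_
    nlinarith [mul_nonneg (sub_nonneg.2 (h.entry_le_one u w)) (sub_nonneg.2 (h.entry_le_one v w))]
  rw [Finset.sum_add_distrib] at h1
  simp only [Finset.sum_const, nsmul_eq_mul, mul_one] at h1
  linarith [h.common_le u hu v hv huv]

/-- Summing a function of the endpoints over the ordered edges inside `U`. -/
lemma sum_sum_endpoints (h : PerronSplit a z U S T r ρ) (g : V → ℝ) :
    ∑ u ∈ U, ∑ v ∈ U, a u v * (g u + g v) = 2 * ∑ u ∈ U, rowSum a U u * g u := by
  have h1 : ∑ u ∈ U, ∑ v ∈ U, a u v * g v = ∑ u ∈ U, rowSum a U u * g u :=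
    sum_sum_mul_eq_sum_rowSum_mul h.symm U U g
  simp only [mul_add, Finset.sum_add_distrib, h1]
  simp only [rowSum, Finset.sum_mul]
  ring

/-- Comparing edge sums over `U` with endpoint functions. -/
lemma sum_rowSum_mul_le (h : PerronSplit a z U S T r ρ) {g k : V → ℝ}
    (hgk : ∀ u ∈ U, ∀ v ∈ U, a u v = 1 → g u + g v ≤ k u + k v) :
    ∑ u ∈ U, rowSum a U u * g u ≤ ∑ u ∈ U, rowSum a U u * k u := by
  have h1 : ∑ u ∈ U, ∑ v ∈ U, a u v * (g u + g v) ≤ ∑ u ∈ U, ∑ v ∈ U, a u v * (k u + k v) := by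
    refine Finset.sum_le_sum fun u hu => Finset.sum_le_sum fun v hv => ?_
    rcases h.zero_or_one u v with e | e
    · simp [e]
    · simpa [e] using hgk u hu v hv e
  rw [h.sum_sum_endpoints, h.sum_sum_endpoints] at h1
  linarith

/-- The excess of `w ∈ T` is controlled by its degree to `U`. -/
lemma le_sum_T (h : PerronSplit a z U S T r ρ) :
    4.5 * r / ρ * ∑ w ∈ T, rowSum a U w ≤
      ∑ w ∈ T, (rowSum a U w * (1 - z w) + (rowSum a S w + rowSum a T w) / 2) := by
  rw [Finset.mul_sum]
  refine Finset.sum_le_sum fun w hw => ?_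
  have := mul_le_mul_of_nonneg_left (h.small w hw) (h.rowSum_nonneg U w)
  linarith [h.rowSum_nonneg S w, h.rowSum_nonneg T w]

lemma excess_nonneg (h : PerronSplit a z U S T r ρ) (w : V) :
    0 ≤ rowSum a U w * (1 - z w) + (rowSum a S w + rowSum a T w) / 2 := by
  have := mul_nonneg (h.rowSum_nonneg U w) (sub_nonneg.2 (h.le_one w))
  linarith [h.rowSum_nonneg S w, h.rowSum_nonneg T w]

/-- The basic upper bound for the weights on `U`. -/
lemma rho_mul_le (h : PerronSplit a z U S T r ρ) {u : V} (hu : u ∈ U) :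
    ρ * z u ≤ 1 + r + S.card + ∑ w ∈ T, rowSum a U w := by
  have hT : rowSum a T u ≤ ∑ w ∈ T, rowSum a U w := by
    refine Finset.sum_le_sum fun w _ => ?_
    rw [h.symm]
    exact Finset.single_le_sum (f := fun y => a w y) (fun _ _ => h.nonneg _ _) hu
  linarith [h.eig_U u hu, h.sum_mul_le_rowSum U u, h.sum_mul_le_rowSum S u,
    h.sum_mul_le_rowSum T u, h.deg_le u hu, h.rowSum_le_card S u]

/-- The degree-weighted sum of weights on `U`, bounded through one step of the eigenvalue
equation. -/
lemma sub_mul_sum_le (h : PerronSplit a z U S T r ρ) :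
    (ρ - r) * ∑ u ∈ U, rowSum a U u * z u ≤
      (∑ u ∈ U, rowSum a U u) / 2 * (S.card + r + 2) + r * ∑ w ∈ T, rowSum a U w := by
  have hU : ∑ u ∈ U, rowSum a U u * ∑ v ∈ U, a u v * z v ≤ r * ∑ u ∈ U, rowSum a U u * z u := by
    have e : ∑ u ∈ U, rowSum a U u * ∑ v ∈ U, a u v * z v ≤ ∑ u ∈ U, r * ∑ v ∈ U, a u v * z v :=
      Finset.sum_le_sum fun u hu => mul_le_mul_of_nonneg_right (h.deg_le u hu)
        (Finset.sum_nonneg fun v _ => mul_nonneg (h.nonneg _ _) (h.pos v).le)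
    refine e.trans_eq ?_
    rw [← Finset.mul_sum, sum_sum_mul_eq_sum_rowSum_mul h.symm]
  have hS : ∑ u ∈ U, rowSum a U u * ∑ w ∈ S, a u w * z w ≤
      (∑ u ∈ U, rowSum a U u) / 2 * (S.card + r) := by
    have e : ∑ u ∈ U, rowSum a U u * ∑ w ∈ S, a u w * z w ≤ ∑ u ∈ U, rowSum a U u * rowSum a S u :=
      Finset.sum_le_sum fun u _ => mul_le_mul_of_nonneg_left (h.sum_mul_le_rowSum S u)
        (h.rowSum_nonneg _ _)
    have e2 := h.sum_rowSum_mul_le (g := rowSum a S) (k := fun _ => (S.card + r) / 2)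
      fun u hu v hv huv => by linarith [h.rowSum_add_rowSum_le hu hv huv]
    rw [← Finset.sum_mul] at e2
    linarith
  have hT : ∑ u ∈ U, rowSum a U u * ∑ w ∈ T, a u w * z w ≤ r * ∑ w ∈ T, rowSum a U w := by
    have e : ∑ u ∈ U, rowSum a U u * ∑ w ∈ T, a u w * z w ≤ ∑ u ∈ U, r * rowSum a T u :=
      Finset.sum_le_sum fun u hu => mul_le_mul (h.deg_le u hu) (h.sum_mul_le_rowSum T u)
        (Finset.sum_nonneg fun v _ => mul_nonneg (h.nonneg _ _) (h.pos v).le)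
        (by linarith [h.one_le_r])
    refine e.trans_eq ?_
    rw [← Finset.mul_sum]
    simp only [rowSum]
    rw [Finset.sum_comm]
    simp only [h.symm]
  have hmain : ρ * ∑ u ∈ U, rowSum a U u * z u = ∑ u ∈ U, rowSum a U u
      + ∑ u ∈ U, rowSum a U u * ∑ v ∈ U, a u v * z v
      + ∑ u ∈ U, rowSum a U u * ∑ w ∈ S, a u w * z w
      + ∑ u ∈ U, rowSum a U u * ∑ w ∈ T, a u w * z w := by
    simp only [← Finset.sum_add_distrib]
    rw [Finset.mul_sum]
    refine Finset.sum_congr rfl fun u hu => ?_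
    linear_combination rowSum a U u * h.eig_U u hu
  linarith

/-- If `S` is small compared with `ρ`, then all weights on `U` are small. -/
lemma lt_third_of_card_le (h : PerronSplit a z U S T r ρ) (hloop : ∀ v, a v v = 0)
    (hs : (S.card : ℝ) ≤ 0.24 * ρ) {u : V} (hu : u ∈ U) : z u < 1 / 3 := by
  have hr := h.one_le_r
  have hρ := h.le_rho
  have hρ1 := h.one_le_rho
  have hP := h.sub_mul_sum_le
  have hI := h.main_le
  have hT := h.le_sum_T
  have hS : 0 ≤ ∑ w ∈ S, (rowSum a U w * (1 - z w) + (rowSum a S w + rowSum a T w) / 2) :=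
    Finset.sum_nonneg fun w _ => h.excess_nonneg w
  have he := h.two_le_sum_rowSum hloop
  have hu' := h.rho_mul_le hu
  have hn : 0 ≤ ∑ w ∈ T, rowSum a U w := Finset.sum_nonneg fun w _ => h.rowSum_nonneg _ _
  have hs0 : (0 : ℝ) ≤ S.card := Nat.cast_nonneg _
  generalize ∑ w ∈ T, rowSum a U w = n at *
  generalize ∑ u ∈ U, rowSum a U u * z u = P at *
  generalize (S.card : ℝ) = s at *
  generalize ∑ u ∈ U, rowSum a U u = e at *
  have h1 : 4.5 * r / ρ * n + e / 2 ≤ 1 + P := by linarith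
  have h2 : (ρ - r) * (4.5 * r / ρ * n) + (ρ - r) * (e / 2) ≤ (ρ - r) + e / 2 * (s + r + 2) + r * n := by
    have := mul_le_mul_of_nonneg_left h1 (by linarith : 0 ≤ ρ - r)
    linarith
  have h3 : (ρ - r) * (4.5 * r / ρ * n) ≥ 4.4 * r * n := by
    have : (ρ - r) * (4.5 * r / ρ * n) = (4.5 * ((ρ - r) / ρ)) * (r * n) := by ring
    have h4 : 238 / 239 ≤ (ρ - r) / ρ := by
      rw [le_div_iff₀ (by linarith)]; linarith
    rw [this]
    have : 0 ≤ r * n := by positivity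
    nlinarith
  have h5 : 3.4 * r * n ≤ s + r + 2 := by nlinarith
  have h6 : 3.4 * n ≤ s + 3 := by
    have : 3.4 * r * n ≤ r * (s + 3) := by nlinarith
    nlinarith
  by_contra hz
  have : ρ * (1 / 3) ≤ ρ * z u := mul_le_mul_of_nonneg_left (not_lt.1 hz) (by linarith)
  linarith

/-- The total weight of `U` missed by `w`. -/
def missed (a : V → V → ℝ) (z : V → ℝ) (U : Finset V) (w : V) : ℝ := ∑ u ∈ U, (1 - a w u) * z u

lemma missed_term_nonneg (h : PerronSplit a z U S T r ρ) (w u : V) : 0 ≤ (1 - a w u) * z u :=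
  mul_nonneg (sub_nonneg.2 (h.entry_le_one _ _)) (h.pos u).le

lemma missed_nonneg (h : PerronSplit a z U S T r ρ) (w : V) : 0 ≤ missed a z U w :=
  Finset.sum_nonneg fun u _ => h.missed_term_nonneg w u

lemma sum_eq_sub_missed (h : PerronSplit a z U S T r ρ) (w : V) :
    ∑ u ∈ U, a w u * z u = ρ - missed a z U w := by
  rw [missed, ← h.sum_U, ← Finset.sum_sub_distrib]
  exact Finset.sum_congr rfl fun u _ => by ring

lemma missed_le (h : PerronSplit a z U S T r ρ) {w : V} (hw : w ∈ S) :
    missed a z U w ≤ ρ * (1 - z w) + (rowSum a S w + rowSum a T w) := by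
  linarith [h.eig_S w hw, h.sum_eq_sub_missed w, h.sum_mul_le_rowSum S w, h.sum_mul_le_rowSum T w]

lemma missed_le_excess (h : PerronSplit a z U S T r ρ) {w : V} (hw : w ∈ S) :
    0.48 * missed a z U w ≤
      rowSum a U w * (1 - z w) + (rowSum a S w + rowSum a T w) / 2 := by
  have hM := h.missed_le hw
  have hM0 := h.missed_nonneg w
  have hd := h.sum_mul_le_rowSum U w
  rw [h.sum_eq_sub_missed] at hd
  have hy : 0 ≤ 1 - z w := sub_nonneg.2 (h.le_one w)
  have hd0 := mul_nonneg (h.rowSum_nonneg U w) hy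
  have hρ := h.le_rho
  have hρ1 := h.one_le_rho
  have hy2 : ρ * (1 - z w) ≤ 4.5 * r := by
    have h1 : 1 - z w ≤ 4.5 * r / ρ := by linarith [h.large w hw]
    have := mul_le_mul_of_nonneg_left h1 (by linarith : 0 ≤ ρ)
    rwa [mul_div_cancel₀ _ (by linarith)] at this
  rcases le_total (missed a z U w) (ρ / 2) with hc | hc
  · have : ρ / 2 * (1 - z w) ≤ rowSum a U w * (1 - z w) :=
      mul_le_mul_of_nonneg_right (by linarith) hy
    linarith
  · linarith

lemma sum_missed (a : V → V → ℝ) (z : V → ℝ) (U S : Finset V) (hsymm : ∀ u v, a u v = a v u) :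
    ∑ w ∈ S, missed a z U w = ∑ u ∈ U, z u * (S.card - rowSum a S u) := by
  simp only [missed]
  rw [Finset.sum_comm]
  refine Finset.sum_congr rfl fun u _ => ?_
  rw [← Finset.sum_mul, Finset.sum_sub_distrib, rowSum]
  simp [hsymm u, mul_comm]

/-- The edge sum over `U`, bounded through the missed weight, when all endpoint weights are at
most `x`. -/
lemma sum_sub_le (h : PerronSplit a z U S T r ρ) (hloop : ∀ v, a v v = 0) (hs : r < S.card)
    {x : ℝ} (hx1 : x ≤ 1) (hx : ∀ u ∈ U, ∀ v ∈ U, a u v = 1 → z u ≤ x) :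
    ∑ u ∈ U, rowSum a U u * z u - (∑ u ∈ U, rowSum a U u) / 2 ≤
      r / (S.card - r) * ∑ w ∈ S, missed a z U w + x - 1 := by
  have hs' : 0 < (S.card : ℝ) - r := sub_pos.2 hs
  have hk0 : ∀ u, 0 ≤ z u * (S.card - rowSum a S u) := fun u =>
    mul_nonneg (h.pos u).le (sub_nonneg.2 (h.rowSum_le_card S u))
  have key := h.sum_rowSum_mul_le (g := fun u => z u - x / 2)
    (k := fun u => z u * (S.card - rowSum a S u) / (S.card - r)) fun u hu v hv huv => by
      rw [← add_div, le_div_iff₀ hs']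
      have h1 := h.rowSum_add_rowSum_le hu hv huv
      have h2 := hx u hu v hv huv
      have h3 := hx v hv u hu (h.symm u v ▸ huv)
      have h4 := h.rowSum_le_card S u
      have h5 := h.rowSum_le_card S v
      have h6 := h.pos u
      have h7 := h.pos v
      rcases le_total (z u) (z v) with hc | hc
      · nlinarith [mul_le_mul_of_nonneg_right hc (sub_nonneg.2 h5),
          mul_le_mul_of_nonneg_left h1 h6.le, mul_le_mul_of_nonneg_right h3 hs'.le]
      · nlinarith [mul_le_mul_of_nonneg_right hc (sub_nonneg.2 h4),
          mul_le_mul_of_nonneg_left h1 h7.le, mul_le_mul_of_nonneg_right h2 hs'.le]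
  have h1 : ∑ u ∈ U, rowSum a U u * (z u * (S.card - rowSum a S u) / (S.card - r)) ≤
      r / (S.card - r) * ∑ w ∈ S, missed a z U w := by
    rw [sum_missed a z U S h.symm, Finset.mul_sum]
    refine Finset.sum_le_sum fun u hu => ?_
    have := mul_le_mul_of_nonneg_right (h.deg_le u hu) (div_nonneg (hk0 u) hs'.le)
    calc _ ≤ _ := this
      _ = _ := by ring
  have h2 : ∑ u ∈ U, rowSum a U u * (z u - x / 2) =
      ∑ u ∈ U, rowSum a U u * z u - (∑ u ∈ U, rowSum a U u) * (x / 2) := by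
    rw [Finset.sum_mul, ← Finset.sum_sub_distrib]
    exact Finset.sum_congr rfl fun u _ => by ring
  have he := h.two_le_sum_rowSum hloop
  nlinarith

set_option maxHeartbeats 1000000 in
/-- If `S` is large, the edges inside `U` force too much missed weight. -/
lemma card_le (h : PerronSplit a z U S T r ρ) (hloop : ∀ v, a v v = 0) :
    (S.card : ℝ) ≤ 0.24 * ρ := by
  classical
  by_contra! hs
  have hr := h.one_le_r
  have hρ := h.le_rho
  have hρ1 := h.one_le_rho
  have hrs : r < S.card := by linarith
  have hs' : 0 < (S.card : ℝ) - r := by linarith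
  have hH0 : 0 ≤ ∑ w ∈ S, missed a z U w := Finset.sum_nonneg fun w _ => h.missed_nonneg w
  have hrH : r / (S.card - r) * ∑ w ∈ S, missed a z U w ≤ 1 / 56 * ∑ w ∈ S, missed a z U w := by
    refine mul_le_mul_of_nonneg_right ?_ hH0
    rw [div_le_iff₀ hs']; linarith
  have hSH : 0.48 * ∑ w ∈ S, missed a z U w ≤
      ∑ w ∈ S, (rowSum a U w * (1 - z w) + (rowSum a S w + rowSum a T w) / 2) := by
    rw [Finset.mul_sum]
    exact Finset.sum_le_sum fun w hw => h.missed_le_excess hw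
  have hT := h.le_sum_T
  have hn : 0 ≤ ∑ w ∈ T, rowSum a U w := Finset.sum_nonneg fun w _ => h.rowSum_nonneg _ _
  have hcoef : 0 ≤ 4.5 * r / ρ := div_nonneg (by linarith) (by linarith)
  have hTn : 0 ≤ 4.5 * r / ρ * ∑ w ∈ T, rowSum a U w := mul_nonneg hcoef hn
  have hI := h.main_le
  have hb := h.sum_sub_le hloop hrs le_rfl fun u _ _ _ _ => h.le_one u
  have hH : ∑ w ∈ S, missed a z U w ≤ 2.17 := by linarith
  have hn2 : 4.5 * ∑ w ∈ T, rowSum a U w ≤ ρ := by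
    have h1 : 4.5 * r / ρ * ∑ w ∈ T, rowSum a U w ≤ 1 := by linarith
    rw [div_mul_eq_mul_div, div_le_one (by linarith)] at h1
    have : 4.5 * ∑ w ∈ T, rowSum a U w ≤ 4.5 * r * ∑ w ∈ T, rowSum a U w := by nlinarith
    linarith
  obtain ⟨τ, hτ⟩ : ∃ τ, ρ * τ = S.card + 0.231 * ρ :=
    ⟨(S.card + 0.231 * ρ) / ρ, mul_div_cancel₀ _ (by linarith)⟩
  have hρ0 : 0 < ρ := by linarith
  have hτ0 : 0.471 < τ := by
    by_contra! hc
    have := mul_le_mul_of_nonneg_left hc hρ0.le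
    linarith
  have hzτ : ∀ u ∈ U, z u ≤ τ := fun u hu => by
    refine le_of_mul_le_mul_left ?_ hρ0
    rw [hτ]
    linarith [h.rho_mul_le hu]
  -- `u` has maximum weight among the endpoints of edges inside `U`
  obtain ⟨u, hu', humax⟩ := Finset.exists_max_image (U.filter fun u => ∃ v ∈ U, a u v = 1) z (by
    obtain ⟨u, hu, v, hv, huv⟩ := h.exists_edge
    exact ⟨u, Finset.mem_filter.2 ⟨hu, v, hv, huv⟩⟩)
  obtain ⟨hu, v, hv, huv⟩ := Finset.mem_filter.1 hu'
  have hvu : a v u = 1 := h.symm u v ▸ huv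
  have hzvu : z v ≤ z u := humax v (Finset.mem_filter.2 ⟨hv, u, hu, hvu⟩)
  have hx := h.sum_sub_le hloop hrs (h.le_one u) fun y hy y' hy' hyy' =>
    humax y (Finset.mem_filter.2 ⟨hy, y', hy', hyy'⟩)
  have hterm : ∀ y ∈ U, z y * (S.card - rowSum a S y) ≤ ∑ w ∈ S, missed a z U w := fun y hy => by
    rw [sum_missed a z U S h.symm]
    exact Finset.single_le_sum (f := fun y => z y * (S.card - rowSum a S y))
      (fun y _ => mul_nonneg (h.pos y).le (sub_nonneg.2 (h.rowSum_le_card S y))) hy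
  have hzv0 := h.pos v
  have hzv : ρ * z v ≤ 18.5 := by
    have h1 := hterm u hu
    have h2 := hterm v hv
    have h3 := h.rowSum_add_rowSum_le hu hv huv
    have h4 := mul_le_mul_of_nonneg_right hzvu (sub_nonneg.2 (h.rowSum_le_card S u))
    have h5 : z v * (S.card - r) ≤ 4.34 := by nlinarith
    have h6 : z v * (0.2358 * ρ) ≤ z v * (S.card - r) :=
      mul_le_mul_of_nonneg_left (by linarith) hzv0.le
    nlinarith
  have hzvb : z v ≤ 0.078 := by
    by_contra! hc
    nlinarith
  have heigv : 1 + z u + 0.98 * rowSum a S v ≤ ρ * z v := by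
    have h1 : z u ≤ ∑ y ∈ U, a v y * z y := by
      have := Finset.single_le_sum (f := fun y => a v y * z y)
        (fun y _ => mul_nonneg (h.nonneg _ _) (h.pos y).le) hu
      simpa [hvu] using this
    have h2 : 0.98 * rowSum a S v ≤ ∑ w ∈ S, a v w * z w := by
      rw [rowSum, Finset.mul_sum]
      refine Finset.sum_le_sum fun w hw => ?_
      have h3 : 4.5 * r / ρ ≤ 0.02 := by
        rw [div_le_iff₀ hρ0]; linarith
      have := mul_le_mul_of_nonneg_left
        (by linarith [h.large w hw] : 0.98 ≤ z w) (h.nonneg v w)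
      linarith
    have h3 : 0 ≤ ∑ w ∈ T, a v w * z w :=
      Finset.sum_nonneg fun y _ => mul_nonneg (h.nonneg _ _) (h.pos y).le
    linarith [h.eig_U v hv]
  have hzu := h.pos u
  have hlow : (1 + z u) * S.card ≤ ρ * (z v * (S.card - rowSum a S v)) := by
    have hβ0 := h.rowSum_nonneg S v
    have hβ : rowSum a S v ≤ 19 := by linarith
    have h1 := mul_le_mul_of_nonneg_right heigv (sub_nonneg.2 (h.rowSum_le_card S v))
    have h2 : 0 ≤ rowSum a S v * (0.98 * (S.card - rowSum a S v) - (1 + z u)) :=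
      mul_nonneg hβ0 (by linarith [h.le_one u])
    nlinarith
  have hex : ∀ w ∈ S, 0.99 * ((1 - a w v) * z v) ≤
      τ * (rowSum a U w * (1 - z w) + (rowSum a S w + rowSum a T w) / 2) := fun w hw => by
    have hy : 0 ≤ 1 - z w := sub_nonneg.2 (h.le_one w)
    have hd0 := mul_nonneg (h.rowSum_nonneg U w) hy
    by_cases hd : rowSum a S w + rowSum a T w = 0
    · have hM : missed a z U w ≤ ρ * (1 - z w) := by linarith [h.missed_le hw]
      have hMH : missed a z U w ≤ 2.17 :=
        (Finset.single_le_sum (fun w _ => h.missed_nonneg w) hw).trans hH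
      have hvM : (1 - a w v) * z v ≤ missed a z U w :=
        Finset.single_le_sum (f := fun y => (1 - a w y) * z y)
          (fun y _ => h.missed_term_nonneg w y) hv
      have hdτ : ρ - missed a z U w ≤ rowSum a U w * τ := by
        rw [← h.sum_eq_sub_missed, rowSum, Finset.sum_mul]
        exact Finset.sum_le_sum fun y hy => mul_le_mul_of_nonneg_left (hzτ y hy) (h.nonneg _ _)
      have h1 : 0.99 * ρ * (1 - z w) ≤ rowSum a U w * τ * (1 - z w) :=
        mul_le_mul_of_nonneg_right (by linarith) hy
      rw [hd]
      linarith
    · have h1 : 1 ≤ rowSum a S w + rowSum a T w := by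
        by_contra! hc
        refine hd ?_
        have hz : ∀ A : Finset V, rowSum a A w < 1 → rowSum a A w = 0 := fun A hA =>
          Finset.sum_eq_zero fun y hy => (h.zero_or_one w y).resolve_right fun e => by
            have := Finset.single_le_sum (f := fun y => a w y) (fun _ _ => h.nonneg _ _) hy
            simp only [rowSum] at hA
            linarith
        rw [hz S (by linarith [h.rowSum_nonneg T w]), hz T (by linarith [h.rowSum_nonneg S w]),
          add_zero]
      have h2 : (1 - a w v) * z v ≤ z v :=
        mul_le_of_le_one_left hzv0.le (by linarith [h.nonneg w v])
      have h3 : 0.471 * (1 / 2) ≤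
          τ * (rowSum a U w * (1 - z w) + (rowSum a S w + rowSum a T w) / 2) :=
        mul_le_mul hτ0.le (by linarith) (by norm_num) (by linarith)
      linarith
  have hsum : 0.99 * (z v * (S.card - rowSum a S v)) ≤
      τ * ∑ w ∈ S, (rowSum a U w * (1 - z w) + (rowSum a S w + rowSum a T w) / 2) := by
    have e : z v * (S.card - rowSum a S v) = ∑ w ∈ S, (1 - a w v) * z v := by
      rw [← Finset.sum_mul, Finset.sum_sub_distrib, rowSum]
      simp [h.symm v, mul_comm]
    rw [e, Finset.mul_sum, Finset.mul_sum]
    exact Finset.sum_le_sum hex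
  have hF : ∑ w ∈ S, (rowSum a U w * (1 - z w) + (rowSum a S w + rowSum a T w) / 2) ≤
      z u + 0.04 := by linarith
  have h1 : 0.99 * (z v * (S.card - rowSum a S v)) ≤ τ * (z u + 0.04) :=
    hsum.trans (mul_le_mul_of_nonneg_left hF (by linarith))
  have h2 : 0.99 * ((1 + z u) * S.card) ≤ (S.card + 0.231 * ρ) * (z u + 0.04) := by
    have h3 := mul_le_mul_of_nonneg_left h1 hρ0.le
    rw [← hτ]
    linarith
  have h3 : ρ * z u ≤ S.card + 0.231 * ρ := hτ ▸ mul_le_mul_of_nonneg_left (hzτ u hu) hρ0.le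
  have h4 : S.card * z u ≤ S.card := mul_le_of_le_one_right (by linarith) (h.le_one u)
  linarith

lemma lt_third (h : PerronSplit a z U S T r ρ) (hloop : ∀ v, a v v = 0) {u : V} (hu : u ∈ U) :
    z u < 1 / 3 :=
  h.lt_third_of_card_le hloop (h.card_le hloop) hu

end PerronSplit

/-- Comparing the number of edges with `ρ ^ 2`, expanded through two steps from a vertex `c`
of weight `1`. -/
lemma sum_excess_le {V : Type*} [Fintype V] {a : V → V → ℝ} {z : V → ℝ} {U S T : Finset V}
    {ρ m : ℝ} {c : V} (hsymm : ∀ u v, a u v = a v u)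
    (hsplit : ∀ f : V → ℝ, ∑ v, f v = f c + ∑ v ∈ U, f v + ∑ v ∈ S, f v + ∑ v ∈ T, f v)
    (hc : a c c = 0) (hcU : ∀ u ∈ U, a u c = 1) (hcS : ∀ w ∈ S, a w c = 0)
    (hcT : ∀ w ∈ T, a w c = 0) (hsum : ∑ u ∈ U, z u = ρ)
    (heig : ∀ u ∈ U, ρ * z u =
      1 + ∑ v ∈ U, a u v * z v + ∑ w ∈ S, a u w * z w + ∑ w ∈ T, a u w * z w)
    (hm : ∑ v, ∑ w, a v w = 2 * m) (hρ : m - 1 ≤ ρ ^ 2) :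
    ∑ w ∈ S, (rowSum a U w * (1 - z w) + (rowSum a S w + rowSum a T w) / 2)
    + ∑ w ∈ T, (rowSum a U w * (1 - z w) + (rowSum a S w + rowSum a T w) / 2)
    + (∑ u ∈ U, rowSum a U u) / 2 ≤ 1 + ∑ u ∈ U, rowSum a U u * z u := by
  have hsq : ρ ^ 2 = U.card + ∑ u ∈ U, rowSum a U u * z u + ∑ w ∈ S, rowSum a U w * z w
      + ∑ w ∈ T, rowSum a U w * z w := by
    rw [← sum_sum_mul_eq_sum_rowSum_mul hsymm U U z, ← sum_sum_mul_eq_sum_rowSum_mul hsymm U S z,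
      ← sum_sum_mul_eq_sum_rowSum_mul hsymm U T z, sq]
    nth_rewrite 2 [← hsum]
    rw [Finset.mul_sum, Finset.sum_congr rfl heig]
    simp [Finset.sum_add_distrib]
  have hrow : ∀ v, ∑ w, a v w = a v c + rowSum a U v + rowSum a S v + rowSum a T v := fun v =>
    hsplit _
  have hswap : ∀ B, ∑ u ∈ U, rowSum a B u = ∑ w ∈ B, rowSum a U w := fun B => by
    simpa [rowSum] using sum_sum_mul_eq_sum_rowSum_mul hsymm U B 1
  have hcc : ∑ w, a c w = U.card := by
    have h0 : ∀ B : Finset V, (∀ w ∈ B, a w c = 0) → rowSum a B c = 0 := fun B hB =>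
      Finset.sum_eq_zero fun w hw => by rw [hsymm, hB w hw]
    have h1 : rowSum a U c = U.card := by
      rw [rowSum, Finset.sum_congr rfl fun u hu => (hsymm c u).trans (hcU u hu)]
      simp
    rw [hrow, hc, h0 S hcS, h0 T hcT, h1]
    ring
  have hU : ∑ v ∈ U, ∑ w, a v w = U.card + ∑ u ∈ U, rowSum a U u + ∑ w ∈ S, rowSum a U w
      + ∑ w ∈ T, rowSum a U w := by
    rw [← hswap S, ← hswap T]
    simp only [hrow, Finset.sum_add_distrib]
    rw [Finset.sum_congr rfl hcU]
    simp
  have hB : ∀ B : Finset V, (∀ w ∈ B, a w c = 0) → ∑ v ∈ B, ∑ w, a v w =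
      ∑ w ∈ B, rowSum a U w + ∑ w ∈ B, (rowSum a S w + rowSum a T w) := fun B hB => by
    simp only [hrow]
    rw [← Finset.sum_add_distrib]
    exact Finset.sum_congr rfl fun w hw => by rw [hB w hw]; ring
  rw [hsplit, hcc, hU, hB S hcS, hB T hcT] at hm
  have hexp : ∀ B : Finset V,
      ∑ w ∈ B, (rowSum a U w * (1 - z w) + (rowSum a S w + rowSum a T w) / 2) =
      ∑ w ∈ B, rowSum a U w - ∑ w ∈ B, rowSum a U w * z w
        + (∑ w ∈ B, (rowSum a S w + rowSum a T w)) / 2 := fun B => by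
    rw [Finset.sum_div, ← Finset.sum_sub_distrib, ← Finset.sum_add_distrib]
    exact Finset.sum_congr rfl fun w _ => by ring
  rw [hexp, hexp]
  linarith

/-- The `PerronSplit` attached to a graph with few common neighbours and large spectral radius. -/
lemma perronSplit_adjMatrix {V : Type*} [Fintype V] [DecidableEq V] (G : SimpleGraph V)
    [DecidableRel G.Adj] {r : ℕ} (hr : 1 ≤ r)
    (hfree : ∀ u v, G.Adj u v → (G.neighborFinset u ∩ G.neighborFinset v).card ≤ r)
    {ρ : ℝ} {x : V → ℝ} (hx : ∀ v, 0 < x v)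
    (heig : (G.adjMatrix ℝ).mulVec x = ρ • x)
    {c : V} (hc : ∀ v, x v ≤ x c)
    (hm2 : (240 * r) ^ 2 ≤ G.edgeFinset.card)
    (hρ2 : (G.edgeFinset.card : ℝ) - 1 + 2 / (ρ - 1) ≤ ρ ^ 2)
    (hEU : ∃ u v, u ∈ G.neighborFinset c ∧ v ∈ G.neighborFinset c ∧ G.Adj u v) :
    PerronSplit (fun u v => G.adjMatrix ℝ u v) (fun v => x v / x c) (G.neighborFinset c)
      ((Finset.univ \ insert c (G.neighborFinset c)).filter
        fun w => 1 - 4.5 * r / ρ ≤ x w / x c)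
      ((Finset.univ \ insert c (G.neighborFinset c)).filter
        fun w => ¬ 1 - 4.5 * r / ρ ≤ x w / x c) r ρ := by
  set U := G.neighborFinset c with hU
  set S := (Finset.univ \ insert c U).filter fun w => 1 - 4.5 * r / ρ ≤ x w / x c with hS
  set T := (Finset.univ \ insert c U).filter fun w => ¬ 1 - 4.5 * r / ρ ≤ x w / x c with hT
  have hxc := hx c
  have hr' : (1 : ℝ) ≤ r := by exact_mod_cast hr
  have hm' : (240 * r : ℝ) ^ 2 ≤ G.edgeFinset.card := by exact_mod_cast hm2
  have hz : ∀ v, ∑ w, G.adjMatrix ℝ v w * (x w / x c) = ρ * (x v / x c) := fun v => by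
    have := congrFun heig v
    simp only [Matrix.mulVec, dotProduct, Pi.smul_apply, smul_eq_mul] at this
    rw [← mul_div_assoc, ← this, Finset.sum_div]
    exact Finset.sum_congr rfl fun w _ => (mul_div_assoc _ _ _).symm
  have hz0 : ∀ v, 0 < x v / x c := fun v => div_pos (hx v) hxc
  have hzc : x c / x c = 1 := div_self hxc.ne'
  have hz1 : ∀ v, x v / x c ≤ 1 := fun v => (div_le_one hxc).2 (hc v)
  have hsymm : ∀ u v, G.adjMatrix ℝ u v = G.adjMatrix ℝ v u := fun u v => by
    simp [SimpleGraph.adjMatrix_apply, G.adj_comm]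
  have hsplit : ∀ f : V → ℝ, ∑ v, f v = f c + ∑ v ∈ U, f v + ∑ v ∈ S, f v + ∑ v ∈ T, f v := by
    intro f
    have hcU : c ∉ U := by simp [hU]
    rw [add_assoc, Finset.sum_filter_add_sum_filter_not, ← Finset.sum_insert hcU, add_comm,
      Finset.sum_sdiff (Finset.subset_univ _)]
  have hcc : G.adjMatrix ℝ c c = 0 := by simp
  have hcU : ∀ u ∈ U, G.adjMatrix ℝ u c = 1 := fun u hu => by
    rw [hU, SimpleGraph.mem_neighborFinset] at hu
    simp [hu.symm]
  have hcW : ∀ w ∈ Finset.univ \ insert c U, G.adjMatrix ℝ w c = 0 := fun w hw => by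
    simp only [hU, Finset.mem_sdiff, Finset.mem_univ, true_and, Finset.mem_insert,
      SimpleGraph.mem_neighborFinset, not_or] at hw
    simp [G.adj_comm, hw.2]
  have hcS : ∀ w ∈ S, G.adjMatrix ℝ w c = 0 := fun w hw => hcW w (Finset.mem_filter.1 hw).1
  have hcT : ∀ w ∈ T, G.adjMatrix ℝ w c = 0 := fun w hw => hcW w (Finset.mem_filter.1 hw).1
  have heigU : ∀ u ∈ U, ρ * (x u / x c) =
      1 + ∑ v ∈ U, G.adjMatrix ℝ u v * (x v / x c) + ∑ w ∈ S, G.adjMatrix ℝ u w * (x w / x c)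
        + ∑ w ∈ T, G.adjMatrix ℝ u w * (x w / x c) := fun u hu => by
    rw [← hz u, hsplit, hcU u hu, hzc, one_mul]
  have hsumU : ∑ u ∈ U, x u / x c = ρ := by
    have h1 := hz c
    have h0 : ∀ B : Finset V, (∀ w ∈ B, G.adjMatrix ℝ w c = 0) →
        ∑ w ∈ B, G.adjMatrix ℝ c w * (x w / x c) = 0 := fun B hB =>
      Finset.sum_eq_zero fun w hw => by rw [hsymm, hB w hw, zero_mul]
    rw [hsplit, hcc, h0 S hcS, h0 T hcT, hzc] at h1
    rw [← mul_one ρ, ← h1, zero_mul, zero_add, add_zero, add_zero]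
    exact Finset.sum_congr rfl fun u hu => by rw [hsymm, hcU u hu, one_mul]
  have hρ1 : 1 ≤ ρ := by
    obtain ⟨u, -, hu, -, -⟩ := hEU
    have hρ0 : 0 ≤ ρ := hsumU ▸ Finset.sum_nonneg fun v _ => (hz0 v).le
    have h1 : x u / x c ≤ ρ := hsumU ▸ Finset.single_le_sum (f := fun v => x v / x c)
      (fun v _ => (hz0 v).le) hu
    have h2 : 1 ≤ ρ * (x u / x c) := by
      have hB : ∀ B : Finset V, 0 ≤ ∑ w ∈ B, G.adjMatrix ℝ u w * (x w / x c) := fun B =>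
        Finset.sum_nonneg fun w _ => mul_nonneg
          (by rw [SimpleGraph.adjMatrix_apply]; split_ifs <;> norm_num) (hz0 w).le
      linarith [heigU u hu, hB U, hB S, hB T]
    nlinarith
  have hρm : (G.edgeFinset.card : ℝ) - 1 ≤ ρ ^ 2 := by
    have : 0 ≤ 2 / (ρ - 1) := div_nonneg (by norm_num) (by linarith)
    linarith
  have hcount : ∀ (A : Finset V) (u : V), rowSum (fun u v => G.adjMatrix ℝ u v) A u =
      ((A ∩ G.neighborFinset u).card : ℝ) := fun A u => by
    simp only [rowSum, SimpleGraph.adjMatrix_apply, Finset.sum_boole]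
    congr 2
    ext w
    simp
  refine
    { symm := hsymm
      zero_or_one := fun u v => by
        simp only [SimpleGraph.adjMatrix_apply]
        split_ifs <;> simp
      one_le_r := hr'
      le_rho := ?_
      pos := hz0
      le_one := hz1
      sum_U := hsumU
      eig_U := heigU
      eig_S := fun w hw => by
        rw [← hz w, hsplit, hcS w hw, zero_mul, zero_add]
      deg_le := fun u hu => by
        rw [hcount]
        exact_mod_cast hfree c u ((G.mem_neighborFinset c u).1 hu)
      common_le := fun u _ v _ huv => ?_
      large := fun w hw => (Finset.mem_filter.1 hw).2
      small := fun w hw => (not_le.1 (Finset.mem_filter.1 hw).2).le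
      exists_edge := ?_
      main_le := sum_excess_le hsymm hsplit hcc hcU hcS hcT hsumU heigU ?_ hρm }
  · nlinarith
  · have hadj : G.Adj u v := by
      by_contra hn
      simp [hn] at huv
    have h1 : ∑ w ∈ S, G.adjMatrix ℝ u w * G.adjMatrix ℝ v w =
        ((S ∩ (G.neighborFinset u ∩ G.neighborFinset v)).card : ℝ) := by
      simp only [SimpleGraph.adjMatrix_apply, ← ite_and, mul_ite, mul_one, mul_zero,
        Finset.sum_boole]
      congr 2
      ext w
      simp [and_comm]
    rw [h1]
    exact_mod_cast (Finset.card_le_card Finset.inter_subset_right).trans (hfree u v hadj)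
  · obtain ⟨u, v, hu, hv, huv⟩ := hEU
    exact ⟨u, hu, v, hv, by simp [huv]⟩
  · have h1 : ∀ v, ∑ w, G.adjMatrix ℝ v w = G.degree v := fun v => by
      rw [← G.card_neighborFinset_eq_degree, G.neighborFinset_eq_filter]
      simp [SimpleGraph.adjMatrix_apply]
    simp only [h1]
    exact_mod_cast G.sum_degrees_eq_twice_card_edges

/-- **Claim 3.3.** Under the section-3 hypotheses, if `G` has an edge with both endpoints in `U`, then `x_u < (1/3) x_{u*}` for every `u ∈ U`. -/
theorem claim_3_3
    {V : Type*} [Fintype V] [DecidableEq V]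
    (G : SimpleGraph V) [DecidableRel G.Adj] (hconn : G.Connected)
    (r : ℕ) (hr : 1 ≤ r)
    (hfree : ∀ u v, G.Adj u v → (G.neighborFinset u ∩ G.neighborFinset v).card ≤ r)
    (hm : 1 ≤ G.edgeFinset.card)
    (ρ : ℝ) (x : V → ℝ) (hx : ∀ v, 0 < x v)
    (heig : (G.adjMatrix ℝ).mulVec x = ρ • x)
    (ustar : V) (hustar : ∀ v, x v ≤ x ustar)
    (U W Wstar : Finset V)
    (hU : U = G.neighborFinset ustar)
    (hW : W = Finset.univ \ insert ustar U)
    (hWstar : Wstar = W.filter (fun w => (1 - 4.5 * r / ρ) * x ustar ≤ x w))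
    (hm2 : (240 * r) ^ 2 ≤ G.edgeFinset.card)
    (hρ2 : (G.edgeFinset.card : ℝ) - 1 + 2 / (ρ - 1) ≤ ρ ^ 2)
    (hEU : ∃ u v, u ∈ U ∧ v ∈ U ∧ G.Adj u v)
    :
    ∀ u ∈ U, x u < (1 / 3) * x ustar := by
  subst hU
  intro u hu
  have h := (perronSplit_adjMatrix G hr hfree hx heig hustar hm2 hρ2 hEU).lt_third
    (by simp) hu
  rwa [div_lt_iff₀ (hx ustar)] at h

end PerronSetup
end

section
/- Under the Perron setup with the section-3 hypotheses (m ≥ (240r)² and ρ² ≥ m − 1 + 2/(ρ − 1)), and assuming additionally that G is non-bipartite, one has W = W* (i.e., x_w ≥ (1 − 4.5r/ρ) x_{u*} for every w ∈ W) and G has no edge with both endpoints in W. -/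
section WeightedPartition

variable {V : Type*} {U W : Finset V} {a : V → V → ℝ} {x : V → ℝ} {ρ r m : ℝ}

/-- The combination of the eigenvalue equations and the edge count for a vertex of maximum
weight `1` with neighbourhood `U` and non-neighbourhood `W`. -/
theorem sq_add_sum_eq_of_eigen (hsym : ∀ u v, a u v = a v u)
    (h0 : ρ = ∑ u ∈ U, x u)
    (hUeq : ∀ u ∈ U, ρ * x u = 1 + ∑ v ∈ U, a u v * x v + ∑ w ∈ W, a u w * x w)
    (hm : 2 * m = 2 * U.card + ∑ u ∈ U, ∑ v ∈ U, a u v + 2 * ∑ w ∈ W, ∑ u ∈ U, a w u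
      + ∑ w ∈ W, ∑ v ∈ W, a w v) :
    ρ ^ 2 + ∑ w ∈ W, ((∑ u ∈ U, a w u) * (1 - x w) + 1 / 2 * ∑ v ∈ W, a w v) =
      m + ∑ u ∈ U, (∑ v ∈ U, a u v) * (x u - 1 / 2) := by
  have h1 : ρ ^ 2 = U.card + ∑ u ∈ U, (∑ v ∈ U, a u v) * x u
      + ∑ w ∈ W, (∑ u ∈ U, a w u) * x w := by
    have e1 : ρ ^ 2 = ∑ u ∈ U, ρ * x u := by rw [← Finset.mul_sum, ← h0, sq]
    rw [e1, Finset.sum_congr rfl hUeq, Finset.sum_add_distrib, Finset.sum_add_distrib,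
      Finset.sum_comm (s := U) (t := U), Finset.sum_comm (s := U) (t := W)]
    simp only [Finset.sum_mul, Finset.sum_const, nsmul_eq_mul, mul_one]
    congr 1
    · congr 1
      exact Finset.sum_congr rfl fun u _ => Finset.sum_congr rfl fun v _ => by rw [hsym]
    · exact Finset.sum_congr rfl fun u _ => Finset.sum_congr rfl fun v _ => by rw [hsym]
  simp only [mul_sub, Finset.sum_add_distrib, Finset.sum_sub_distrib, mul_one,
    ← Finset.mul_sum, ← Finset.sum_mul]
  rw [h1]
  linarith

/-- The defect `d_U(w) (1 - x_w)` controls the weight of the non-neighbours of `w` in `U`. -/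
theorem weight_mul_missing_le (ha0 : ∀ u v, 0 ≤ a u v)
    (hx1 : ∀ v, x v ≤ 1) (h0 : ρ = ∑ u ∈ U, x u)
    {w : V} (hWeq : ρ * x w = ∑ u ∈ U, a w u * x u + ∑ v ∈ W, a w v * x v) :
    x w * ∑ u ∈ U, (1 - a w u) * x u ≤
      (∑ u ∈ U, a w u) * (1 - x w) + ∑ v ∈ W, a w v := by
  have hM : ∑ u ∈ U, (1 - a w u) * x u = ρ - ∑ u ∈ U, a w u * x u := by
    simp [sub_mul, Finset.sum_sub_distrib, h0]
  have hd : ∑ u ∈ U, a w u * x u ≤ ∑ u ∈ U, a w u :=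
    Finset.sum_le_sum fun u _ => mul_le_of_le_one_right (ha0 w u) (hx1 u)
  have hy : ∑ v ∈ W, a w v * x v ≤ ∑ v ∈ W, a w v :=
    Finset.sum_le_sum fun u _ => mul_le_of_le_one_right (ha0 w u) (hx1 u)
  rw [hM]
  have := mul_le_mul_of_nonneg_right hd (sub_nonneg.2 (hx1 w))
  nlinarith

/-- If adjacent `u, v ∈ U` have few common neighbours, then `v` misses much of the weight
of `W`. -/
theorem le_missing_weight (ha : ∀ u v, a u v = 0 ∨ a u v = 1)
    (hx0 : ∀ v, 0 < x v) (hx1 : ∀ v, x v ≤ 1) {u v : V}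
    (hUeq : ρ * x u = 1 + ∑ v ∈ U, a u v * x v + ∑ w ∈ W, a u w * x w)
    (hdeg : ∑ v ∈ U, a u v ≤ r)
    (hcom : ∑ w ∈ W, a u w * a v w ≤ r - 1) :
    ρ * x u - 2 * r ≤ ∑ w ∈ W, (1 - a v w) * x w := by
  have h1 : ∑ v ∈ U, a u v * x v ≤ ∑ v ∈ U, a u v :=
    Finset.sum_le_sum fun z _ => mul_le_of_le_one_right
      (by rcases ha u z with h | h <;> simp [h]) (hx1 z)
  have h2 : ∑ w ∈ W, a u w * x w ≤ ∑ w ∈ W, a u w * a v w + ∑ w ∈ W, (1 - a v w) * x w := by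
    rw [← Finset.sum_add_distrib]
    refine Finset.sum_le_sum fun w _ => ?_
    have := hx0 w
    have := hx1 w
    rcases ha u w with h | h <;> rcases ha v w with h' | h' <;> simp [h, h'] <;> linarith
  linarith

theorem internal_excess_le (ha : ∀ u v, a u v = 0 ∨ a u v = 1) (hsym : ∀ u v, a u v = a v u)
    (hx0 : ∀ v, 0 < x v) (hx1 : ∀ v, x v ≤ 1) (hdeg : ∀ u ∈ U, ∑ v ∈ U, a u v ≤ r)
    (P : V → Prop) [DecidablePred P]
    (hP : ∀ u ∈ U, ∀ v ∈ U, a u v = 1 → 1 / 2 ≤ x u → P v) :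
    ∑ u ∈ U, (∑ v ∈ U, a u v) * (x u - 1 / 2) ≤ r * ∑ v ∈ U.filter P, x v := by
  have key : ∀ u ∈ U, ∀ v ∈ U, a u v * (x u - 1 / 2) + a u v * (x v - 1 / 2) ≤
      a u v * (if P u then x u else 0) + a u v * (if P v then x v else 0) := by
    intro u hu v hv
    rcases ha u v with h | h
    · simp [h]
    · have h' : a v u = 1 := by rw [hsym, h]
      have pu := hP u hu v hv h
      have pv := hP v hv u hu h'
      have := hx0 u
      have := hx1 u
      have := hx0 v
      have := hx1 v
      rw [h]
      by_cases c1 : 1 / 2 ≤ x u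
      · rw [if_pos (pu c1)]
        split_ifs <;> linarith
      · by_cases c2 : 1 / 2 ≤ x v
        · rw [if_pos (pv c2)]
          split_ifs <;> linarith
        · split_ifs <;> linarith
  have hs : ∀ g : V → ℝ, ∑ u ∈ U, ∑ v ∈ U, a u v * g v = ∑ u ∈ U, ∑ v ∈ U, a u v * g u := by
    intro g
    rw [Finset.sum_comm]
    exact Finset.sum_congr rfl fun u _ => Finset.sum_congr rfl fun v _ => by rw [hsym]
  have h2 := Finset.sum_le_sum fun u hu => Finset.sum_le_sum fun v hv => key u hu v hv
  simp only [Finset.sum_add_distrib] at h2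
  rw [hs fun v => x v - 1 / 2, hs fun v => if P v then x v else 0] at h2
  have h3 : ∑ u ∈ U, ∑ v ∈ U, a u v * (if P u then x u else 0) ≤
      ∑ u ∈ U, r * (if P u then x u else 0) := by
    refine Finset.sum_le_sum fun u hu => ?_
    rw [← Finset.sum_mul]
    exact mul_le_mul_of_nonneg_right (hdeg u hu) (by split_ifs; exacts [(hx0 u).le, le_rfl])
  rw [← Finset.mul_sum, ← Finset.sum_filter] at h3
  simp only [Finset.sum_mul]
  linarith

/-- The internal edges of `U` contribute nonpositively when the total defect on `W` exceeds
their contribution by less than `1`. -/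
theorem internal_excess_nonpos (ha : ∀ u v, a u v = 0 ∨ a u v = 1)
    (hsym : ∀ u v, a u v = a v u)
    (hx0 : ∀ v, 0 < x v) (hx1 : ∀ v, x v ≤ 1) (h0 : ρ = ∑ u ∈ U, x u)
    (hUeq : ∀ u ∈ U, ρ * x u = 1 + ∑ v ∈ U, a u v * x v + ∑ w ∈ W, a u w * x w)
    (hWeq : ∀ w ∈ W, ρ * x w = ∑ u ∈ U, a w u * x u + ∑ v ∈ W, a w v * x v)
    (hdeg : ∀ u ∈ U, ∑ v ∈ U, a u v ≤ r)
    (hcom : ∀ u ∈ U, ∀ v ∈ U, a u v = 1 → ∑ w ∈ W, a u w * a v w ≤ r - 1)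
    (hr : 1 ≤ r) (hρr : 239 * r ≤ ρ)
    (hF : ∑ w ∈ W, ((∑ u ∈ U, a w u) * (1 - x w) + 1 / 2 * ∑ v ∈ W, a w v) ≤
      1 + ∑ u ∈ U, (∑ v ∈ U, a u v) * (x u - 1 / 2)) :
    ∑ u ∈ U, (∑ v ∈ U, a u v) * (x u - 1 / 2) ≤ 0 := by
  classical
  have ha0 : ∀ u v, 0 ≤ a u v := fun u v => by rcases ha u v with h | h <;> simp [h]
  have ha1 : ∀ u v, 0 ≤ 1 - a u v := fun u v => by rcases ha u v with h | h <;> simp [h]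
  set Q := ∑ u ∈ U, (∑ v ∈ U, a u v) * (x u - 1 / 2) with hQ
  set F := ∑ w ∈ W, ((∑ u ∈ U, a w u) * (1 - x w) + 1 / 2 * ∑ v ∈ W, a w v) with hFdef
  have hswap : ∀ S : Finset V, ∑ w ∈ S, x w * ∑ u ∈ U, (1 - a w u) * x u =
      ∑ u ∈ U, x u * ∑ w ∈ S, (1 - a u w) * x w := by
    intro S
    simp only [Finset.mul_sum]
    rw [Finset.sum_comm]
    exact Finset.sum_congr rfl fun u _ => Finset.sum_congr rfl fun v _ => by
      rw [hsym]; ring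
  have hdW : ∀ w, 0 ≤ ∑ v ∈ W, a w v := fun w => Finset.sum_nonneg fun v _ => ha0 w v
  have hdU : ∀ w, 0 ≤ (∑ u ∈ U, a w u) * (1 - x w) := fun w =>
    mul_nonneg (Finset.sum_nonneg fun v _ => ha0 w v) (sub_nonneg.2 (hx1 w))
  have hmiss := fun w hw => weight_mul_missing_le ha0 hx1 h0 (hWeq w hw)
  have h2F : ∑ u ∈ U, x u * ∑ w ∈ W, (1 - a u w) * x w ≤ 2 * F := by
    rw [← hswap, hFdef, Finset.mul_sum]
    refine Finset.sum_le_sum fun w hw => ?_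
    have := hmiss w hw
    have := hdU w
    linarith
  let P : V → Prop := fun v => ∃ u ∈ U, a u v = 1 ∧ 1 / 2 ≤ x u
  have hQP : Q ≤ r * ∑ v ∈ U.filter P, x v :=
    internal_excess_le ha hsym hx0 hx1 hdeg P fun u hu v _ h1 h2 => ⟨u, hu, h1, h2⟩
  have hD := fun u hu v hv h => le_missing_weight ha hx0 hx1 (hUeq u hu) (hdeg u hu)
    (hcom u hu v hv h)
  have hPF : (ρ / 2 - 2 * r) * ∑ v ∈ U.filter P, x v ≤ 2 * F := by
    refine le_trans ?_ h2F
    rw [Finset.mul_sum]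
    refine le_trans (Finset.sum_le_sum fun v hv => ?_)
      (Finset.sum_le_sum_of_subset_of_nonneg (Finset.filter_subset P U) fun v _ _ =>
        mul_nonneg (hx0 v).le (Finset.sum_nonneg fun w _ => mul_nonneg (ha1 _ _) (hx0 w).le))
    obtain ⟨hvU, u, hu, h1, h2⟩ := Finset.mem_filter.1 hv
    have := hD u hu v hvU h1
    rw [mul_comm]
    refine mul_le_mul_of_nonneg_left ?_ (hx0 v).le
    nlinarith
  have hF2 : F ≤ 1.02 := by
    have hS : 0 ≤ ∑ v ∈ U.filter P, x v := Finset.sum_nonneg fun v _ => (hx0 v).le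
    have : 117 * r * ∑ v ∈ U.filter P, x v ≤ 2 * F :=
      le_trans (mul_le_mul_of_nonneg_right (by linarith) hS) hPF
    linarith
  by_contra! hQpos
  obtain ⟨u, hu, v, hv, huv, hsum⟩ : ∃ u ∈ U, ∃ v ∈ U, a u v = 1 ∧ 1 < x u + x v := by
    by_contra! hno
    have h1 : ∑ u ∈ U, ∑ v ∈ U, a u v * (x u + x v - 1) ≤ 0 := by
      refine Finset.sum_nonpos fun u hu => Finset.sum_nonpos fun v hv => ?_
      rcases ha u v with h | h
      · simp [h]
      · have := hno u hu v hv h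
        rw [h]
        linarith
    have h2 : ∑ u ∈ U, ∑ v ∈ U, a u v * (x v - 1 / 2) = Q := by
      rw [Finset.sum_comm, hQ]
      simp only [Finset.sum_mul]
      exact Finset.sum_congr rfl fun u _ => Finset.sum_congr rfl fun v _ => by rw [hsym]
    have h3 : ∑ u ∈ U, ∑ v ∈ U, a u v * (x u + x v - 1) = 2 * Q := by
      rw [two_mul]
      nth_rewrite 1 [hQ]
      rw [← h2]
      simp only [Finset.sum_mul, ← Finset.sum_add_distrib]
      exact Finset.sum_congr rfl fun u _ => Finset.sum_congr rfl fun v _ => by ring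
    linarith
  wlog hle : x v ≤ x u generalizing u v
  · exact this v hv u hu (by rw [hsym, huv]) (by linarith) (by linarith)
  -- only the vertices of `W` without neighbours in `W` are used for the sharper bound
  let W₀ := W.filter fun w => ∑ v ∈ W, a w v = 0
  have hF0 : x v * ∑ w ∈ W₀, (1 - a v w) * x w ≤ F := by
    have e1 : x v * ∑ w ∈ W₀, (1 - a v w) * x w ≤ ∑ u ∈ U, x u * ∑ w ∈ W₀, (1 - a u w) * x w :=
      Finset.single_le_sum (f := fun u => x u * ∑ w ∈ W₀, (1 - a u w) * x w) (fun v _ =>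
        mul_nonneg (hx0 v).le (Finset.sum_nonneg fun w _ => mul_nonneg (ha1 _ _) (hx0 w).le)) hv
    refine e1.trans ?_
    rw [← hswap, hFdef]
    refine le_trans (Finset.sum_le_sum fun w hw => ?_)
      (Finset.sum_le_sum_of_subset_of_nonneg (Finset.filter_subset _ W) fun w _ _ =>
        add_nonneg (hdU w) (mul_nonneg (by norm_num) (hdW w)))
    obtain ⟨hwW, hw0⟩ := Finset.mem_filter.1 hw
    have := hmiss w hwW
    rw [hw0] at this ⊢
    linarith
  have hW0 : ∑ w ∈ W, (1 - a v w) * x w ≤ ∑ w ∈ W₀, (1 - a v w) * x w + 2 * F := by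
    rw [Finset.sum_filter, hFdef, Finset.mul_sum, ← Finset.sum_add_distrib]
    refine Finset.sum_le_sum fun w hw => ?_
    have := hdU w
    have := hdW w
    split_ifs with h
    · linarith
    · have h1 : 1 ≤ ∑ v ∈ W, a w v := by
        obtain ⟨z, hz, hz0⟩ := Finset.exists_ne_zero_of_sum_ne_zero h
        have := Finset.single_le_sum (f := a w) (fun v _ => ha0 w v) hz
        rcases ha w z with h | h
        · exact absurd h hz0
        · linarith
      have h2 : (1 - a v w) * x w ≤ 1 :=
        mul_le_one₀ (by linarith [ha0 v w]) (hx0 w).le (hx1 w)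
      linarith
  have hDv := hD u hu v hv huv
  have hxv : 1 + x u ≤ ρ * x v := by
    rw [hUeq v hv]
    have e1 : x u ≤ ∑ z ∈ U, a v z * x z := by
      have := Finset.single_le_sum (f := fun z => a v z * x z)
        (fun z _ => mul_nonneg (ha0 v z) (hx0 z).le) hu
      simpa [hsym v u, huv] using this
    have e2 : 0 ≤ ∑ w ∈ W, a v w * x w :=
      Finset.sum_nonneg fun z _ => mul_nonneg (ha0 v z) (hx0 z).le
    linarith
  have hbig : x v * (ρ * x u - 5 / 239 * ρ) ≤ 1.02 :=
    (mul_le_mul_of_nonneg_left (by linarith) (hx0 v).le).trans (hF0.trans hF2)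
  have hbig' : (ρ * x v) * (x u - 5 / 239) ≤ 1.02 := by
    have : x v * (ρ * x u - 5 / 239 * ρ) = (ρ * x v) * (x u - 5 / 239) := by ring
    linarith
  have hu2 : 1 / 2 < x u := by linarith
  rcases le_or_gt (x u) (0.9) with h | h
  · have : 23.9 ≤ ρ * x v := by nlinarith [hx0 v]
    nlinarith
  · nlinarith

theorem no_edge_and_weight_bound (ha : ∀ u v, a u v = 0 ∨ a u v = 1)
    (hsym : ∀ u v, a u v = a v u) (hloop : ∀ v, a v v = 0)
    (hx0 : ∀ v, 0 < x v) (hx1 : ∀ v, x v ≤ 1) (h0 : ρ = ∑ u ∈ U, x u)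
    (hUeq : ∀ u ∈ U, ρ * x u = 1 + ∑ v ∈ U, a u v * x v + ∑ w ∈ W, a u w * x w)
    (hWeq : ∀ w ∈ W, ρ * x w = ∑ u ∈ U, a w u * x u + ∑ v ∈ W, a w v * x v)
    (hdeg : ∀ u ∈ U, ∑ v ∈ U, a u v ≤ r)
    (hcom : ∀ u ∈ U, ∀ v ∈ U, a u v = 1 → ∑ w ∈ W, a u w * a v w ≤ r - 1)
    (hr : 1 ≤ r) (hρr : 239 * r ≤ ρ)
    (hm : 2 * m = 2 * U.card + ∑ u ∈ U, ∑ v ∈ U, a u v + 2 * ∑ w ∈ W, ∑ u ∈ U, a w u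
      + ∑ w ∈ W, ∑ v ∈ W, a w v)
    (hρ2 : m - 1 + 2 / (ρ - 1) ≤ ρ ^ 2) :
    (∀ w ∈ W, 1 - 4.5 * r / ρ ≤ x w) ∧ ∀ w ∈ W, ∀ v ∈ W, a w v = 0 := by
  have ha0 : ∀ u v, 0 ≤ a u v := fun u v => by rcases ha u v with h | h <;> simp [h]
  have hid := sq_add_sum_eq_of_eigen hsym h0 hUeq hm
  have hpos : 0 < 2 / (ρ - 1) := div_pos two_pos (by linarith)
  have hQ := internal_excess_nonpos ha hsym hx0 hx1 h0 hUeq hWeq hdeg hcom hr hρr (by linarith)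
  have hdW : ∀ w, 0 ≤ ∑ v ∈ W, a w v := fun w => Finset.sum_nonneg fun v _ => ha0 w v
  have hdU : ∀ w, 0 ≤ (∑ u ∈ U, a w u) * (1 - x w) := fun w =>
    mul_nonneg (Finset.sum_nonneg fun v _ => ha0 w v) (sub_nonneg.2 (hx1 w))
  have hF : ∑ w ∈ W, ((∑ u ∈ U, a w u) * (1 - x w) + 1 / 2 * ∑ v ∈ W, a w v) ≤
      1 - 2 / (ρ - 1) := by linarith
  have hnone : ∀ w ∈ W, ∀ v ∈ W, a w v = 0 := by
    intro w hw v hv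
    rcases ha w v with h | h
    · exact h
    exfalso
    have hwv : w ≠ v := by
      rintro rfl
      simp [hloop] at h
    have hle : ∀ p ∈ W, ∀ q ∈ W, a p q = 1 → 1 / 2 ≤
        (∑ u ∈ U, a p u) * (1 - x p) + 1 / 2 * ∑ v ∈ W, a p v := fun p _ q hq hpq => by
      have := Finset.single_le_sum (f := a p) (fun z _ => ha0 p z) hq
      have := hdU p
      linarith
    have hpair := Finset.add_le_sum
      (f := fun w => (∑ u ∈ U, a w u) * (1 - x w) + 1 / 2 * ∑ v ∈ W, a w v)
      (fun z _ => add_nonneg (hdU z) (mul_nonneg (by norm_num) (hdW z))) hw hv hwv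
    have := hle w hw v hv h
    have := hle v hv w hw (by rw [hsym, h])
    linarith
  refine ⟨fun w hw => ?_, hnone⟩
  have hw0 : ∑ v ∈ W, a w v = 0 := Finset.sum_eq_zero fun v hv => hnone w hw v hv
  have hf : (∑ u ∈ U, a w u) * (1 - x w) ≤ 1 - 2 / (ρ - 1) := by
    have := Finset.single_le_sum
      (f := fun w => (∑ u ∈ U, a w u) * (1 - x w) + 1 / 2 * ∑ v ∈ W, a w v)
      (fun z _ => add_nonneg (hdU z) (mul_nonneg (by norm_num) (hdW z))) hw
    simp only [hw0] at this
    linarith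
  have hd : ρ * x w ≤ ∑ u ∈ U, a w u := by
    rw [hWeq w hw, Finset.sum_eq_zero (s := W) fun v hv => by rw [hnone w hw v hv, zero_mul],
      add_zero]
    exact Finset.sum_le_sum fun u _ => mul_le_of_le_one_right (ha0 w u) (hx1 u)
  have hd1 : 1 ≤ ∑ u ∈ U, a w u := by
    have : ∑ u ∈ U, a w u ≠ 0 := by
      have := mul_pos (show 0 < ρ by linarith) (hx0 w)
      linarith
    obtain ⟨z, hz, hz0⟩ := Finset.exists_ne_zero_of_sum_ne_zero this
    have := Finset.single_le_sum (f := a w) (fun v _ => ha0 w v) hz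
    rcases ha w z with h | h
    · exact absurd h hz0
    · linarith
  generalize (∑ u ∈ U, a w u) = d at hf hd hd1
  have hρ : 0 < ρ := by linarith
  by_contra! hlt
  have hlt' : 4.5 * r < ρ * (1 - x w) := by
    have : 4.5 * r / ρ < 1 - x w := by linarith
    rw [div_lt_iff₀ hρ] at this
    linarith
  rcases le_or_gt (x w) (1 / 2) with h | h
  · rcases le_or_gt (d + 1) ρ with h' | h'
    · have h1 : 1 / ρ < 2 / (ρ - 1) := by
        rw [div_lt_div_iff₀ hρ (by linarith)]
        linarith
      have h2 : ρ * (1 / ρ) = 1 := by field_simp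
      have h3 : ρ * (d * (1 - x w)) < ρ * (1 - 1 / ρ) := by
        apply mul_lt_mul_of_pos_left _ hρ
        linarith
      nlinarith [mul_nonneg (sub_nonneg.2 hd1) (sub_nonneg.2 h')]
    · nlinarith
  · nlinarith [mul_le_mul_of_nonneg_right hd (sub_nonneg.2 (hx1 w))]

end WeightedPartition


section PerronSetup

variable {V : Type*} [Fintype V] [DecidableEq V]

/-- **Claim 3.4.** Under the section-3 hypotheses, if `G` is moreover non-bipartite then `W = W*` (every `w ∈ W` has `x_w ≥ (1 - 4.5r/ρ) x_{u*}`) and `G` has no edge inside `W`. -/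
theorem claim_3_4
    {V : Type*} [Fintype V] [DecidableEq V]
    (G : SimpleGraph V) [DecidableRel G.Adj] (hconn : G.Connected)
    (r : ℕ) (hr : 1 ≤ r)
    (hfree : ∀ u v, G.Adj u v → (G.neighborFinset u ∩ G.neighborFinset v).card ≤ r)
    (hm : 1 ≤ G.edgeFinset.card)
    (ρ : ℝ) (x : V → ℝ) (hx : ∀ v, 0 < x v)
    (heig : (G.adjMatrix ℝ).mulVec x = ρ • x)
    (ustar : V) (hustar : ∀ v, x v ≤ x ustar)
    (U W Wstar : Finset V)
    (hU : U = G.neighborFinset ustar)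
    (hW : W = Finset.univ \ insert ustar U)
    (hWstar : Wstar = W.filter (fun w => (1 - 4.5 * r / ρ) * x ustar ≤ x w))
    (hm2 : (240 * r) ^ 2 ≤ G.edgeFinset.card)
    (hρ2 : (G.edgeFinset.card : ℝ) - 1 + 2 / (ρ - 1) ≤ ρ ^ 2)
    (hnb : ¬ G.Colorable 2)
    :
    (∀ w ∈ W, (1 - 4.5 * r / ρ) * x ustar ≤ x w) ∧
    (∀ u v, u ∈ W → v ∈ W → ¬ G.Adj u v) := by
  classical
  set a : V → V → ℝ := fun u v => G.adjMatrix ℝ u v with hadef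
  have haA : ∀ u v, a u v = if G.Adj u v then 1 else 0 := fun u v => by
    simp [hadef, SimpleGraph.adjMatrix_apply]
  have ha : ∀ u v, a u v = 0 ∨ a u v = 1 := fun u v => by
    rw [haA]; split_ifs <;> simp
  have ha_one : ∀ {u v}, a u v = 1 ↔ G.Adj u v := fun {u v} => by
    rw [haA]; split_ifs with h <;> simp [h]
  have hsym : ∀ u v, a u v = a v u := fun u v => by simp only [haA, G.adj_comm]
  have hloop : ∀ v, a v v = 0 := fun v => by simp [haA]
  have hmemU : ∀ v, v ∈ U ↔ G.Adj ustar v := fun v => by simp [hU]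
  have hsplit : ∀ g : V → ℝ, ∑ v, g v = g ustar + ∑ v ∈ U, g v + ∑ v ∈ W, g v := by
    intro g
    have hnot : ustar ∉ U := by simp [hmemU]
    rw [← Finset.sum_insert hnot, hW, add_comm, Finset.sum_sdiff (Finset.subset_univ _)]
  have hsU : ∀ u ∈ U, a u ustar = 1 := fun u hu => ha_one.2 ((hmemU u).1 hu).symm
  have hsW : ∀ w ∈ W, a w ustar = 0 := fun w hw => by
    have : ¬ G.Adj w ustar := fun h => by
      simp [hW, hmemU, h.symm] at hw
    rw [haA, if_neg this]
  have hxs := hx ustar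
  set y : V → ℝ := fun v => x v / x ustar with hydef
  have hys : y ustar = 1 := div_self hxs.ne'
  have hy0 : ∀ v, 0 < y v := fun v => div_pos (hx v) hxs
  have hy1 : ∀ v, y v ≤ 1 := fun v => (div_le_one hxs).2 (hustar v)
  have heq : ∀ v, ρ * y v = ∑ w, a v w * y w := by
    intro v
    have h := congrFun heig v
    simp only [Matrix.mulVec, dotProduct, Pi.smul_apply, smul_eq_mul] at h
    simp only [hydef, ← mul_div_assoc, ← Finset.sum_div]
    rw [← h]
  have h0 : ρ = ∑ u ∈ U, y u := by
    have h := heq ustar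
    have h1 : ∑ u ∈ U, a ustar u * y u = ∑ u ∈ U, y u :=
      Finset.sum_congr rfl fun u hu => by rw [hsym, hsU u hu, one_mul]
    have h2 : ∑ w ∈ W, a ustar w * y w = 0 :=
      Finset.sum_eq_zero fun w hw => by rw [hsym, hsW w hw, zero_mul]
    rw [hsplit, hys, hloop, h1, h2] at h
    linarith
  have hUeq : ∀ u ∈ U, ρ * y u = 1 + ∑ v ∈ U, a u v * y v + ∑ w ∈ W, a u w * y w := by
    intro u hu
    rw [heq, hsplit, hys, hsU u hu, one_mul]
  have hWeq : ∀ w ∈ W, ρ * y w = ∑ u ∈ U, a w u * y u + ∑ v ∈ W, a w v * y v := by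
    intro w hw
    rw [heq, hsplit, hys, hsW w hw, zero_mul, zero_add]
  have hinter : ∀ u v, (((G.neighborFinset u ∩ G.neighborFinset v).card : ℕ) : ℝ) =
      ∑ w, a u w * a v w := by
    intro u v
    simp only [haA, ← ite_and, mul_ite, mul_one, mul_zero, Finset.sum_boole]
    congr 2
    ext w
    simp [and_comm]
  have hdeg : ∀ u ∈ U, ∑ v ∈ U, a u v ≤ r := by
    intro u hu
    have h1 : ∑ w, a ustar w * a u w = ∑ v ∈ U, a u v := by
      have e1 : ∑ v ∈ U, a ustar v * a u v = ∑ v ∈ U, a u v :=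
        Finset.sum_congr rfl fun v hv => by rw [hsym ustar, hsU v hv, one_mul]
      have e2 : ∑ v ∈ W, a ustar v * a u v = 0 :=
        Finset.sum_eq_zero fun v hv => by rw [hsym ustar, hsW v hv, zero_mul]
      rw [hsplit, hloop, e1, e2]
      ring
    rw [← h1, ← hinter]
    exact_mod_cast hfree ustar u ((hmemU u).1 hu)
  have hcom : ∀ u ∈ U, ∀ v ∈ U, a u v = 1 → ∑ w ∈ W, a u w * a v w ≤ (r : ℝ) - 1 := by
    intro u hu v hv huv
    have h1 : ∑ w, a u w * a v w ≤ r := by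
      rw [← hinter]
      exact_mod_cast hfree u v (ha_one.1 huv)
    rw [hsplit, hsU u hu, hsU v hv] at h1
    have : 0 ≤ ∑ w ∈ U, a u w * a v w := Finset.sum_nonneg fun w _ => by
      rcases ha u w with h | h <;> rcases ha v w with h' | h' <;> simp [h, h']
    linarith
  have hcount : 2 * (G.edgeFinset.card : ℝ) = 2 * U.card + ∑ u ∈ U, ∑ v ∈ U, a u v
      + 2 * ∑ w ∈ W, ∑ u ∈ U, a w u + ∑ w ∈ W, ∑ v ∈ W, a w v := by
    have h1 : 2 * (G.edgeFinset.card : ℝ) = ∑ v, ∑ w, a v w := by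
      have := G.sum_degrees_eq_twice_card_edges
      have h2 : ∀ v, ∑ w, a v w = (G.degree v : ℝ) := fun v => by
        simp [haA, Finset.sum_boole, ← SimpleGraph.card_neighborFinset_eq_degree,
          SimpleGraph.neighborFinset_eq_filter]
      simp only [h2]
      exact_mod_cast this.symm
    have e1 : ∑ v ∈ U, a ustar v = U.card := by
      rw [Finset.sum_congr rfl fun v hv => by rw [hsym, hsU v hv]]
      simp
    have e2 : ∑ v ∈ W, a ustar v = 0 :=
      Finset.sum_eq_zero fun v hv => by rw [hsym, hsW v hv]
    have e3 : ∑ u ∈ U, ∑ w, a u w =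
        U.card + ∑ u ∈ U, ∑ v ∈ U, a u v + ∑ w ∈ W, ∑ u ∈ U, a w u := by
      rw [Finset.sum_comm (s := W), Finset.sum_congr rfl fun u hu => by rw [hsplit, hsU u hu]]
      simp only [Finset.sum_add_distrib, Finset.sum_const, nsmul_eq_mul, mul_one]
      congr 1
      exact Finset.sum_congr rfl fun u _ => Finset.sum_congr rfl fun v _ => hsym u v
    have e4 : ∑ w ∈ W, ∑ v, a w v = ∑ w ∈ W, ∑ u ∈ U, a w u + ∑ w ∈ W, ∑ v ∈ W, a w v := by
      rw [Finset.sum_congr rfl fun u hu => by rw [hsplit, hsW u hu, zero_add]]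
      rw [Finset.sum_add_distrib]
    rw [h1, hsplit, hsplit (a ustar), hloop, e1, e2, e3, e4]
    ring
  have hUne : U.Nonempty := by
    obtain ⟨e, he⟩ := Finset.card_pos.1 hm
    induction e with
    | h p q =>
      have hpq : G.Adj p q := by simpa using he
      have : Nontrivial V := ⟨p, q, hpq.ne⟩
      obtain ⟨v, hv⟩ := hconn.preconnected.exists_adj_of_nontrivial ustar
      exact ⟨v, (hmemU v).2 hv⟩
  have hρ0 : 0 < ρ := by
    rw [h0]
    exact Finset.sum_pos (fun u _ => hy0 u) hUne
  have hr1 : (1 : ℝ) ≤ r := by exact_mod_cast hr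
  have hm3 : (240 * (r : ℝ)) ^ 2 ≤ G.edgeFinset.card := by exact_mod_cast hm2
  have hρ1 : 1 ≤ ρ := by
    obtain ⟨u, hu⟩ := hUne
    have h1 : y u ≤ ρ := by
      rw [h0]
      exact Finset.single_le_sum (fun v _ => (hy0 v).le) hu
    have h2 : 1 ≤ ρ * y u := by
      rw [hUeq u hu]
      have hnn : ∀ S : Finset V, 0 ≤ ∑ v ∈ S, a u v * y v := fun S =>
        Finset.sum_nonneg fun w _ => mul_nonneg
          (by rcases ha u w with h | h <;> simp [h]) (hy0 w).le
      linarith [hnn U, hnn W]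
    nlinarith
  have hρr : 239 * (r : ℝ) ≤ ρ := by
    have : 0 ≤ 2 / (ρ - 1) := div_nonneg zero_le_two (by linarith)
    nlinarith
  obtain ⟨hA, hB⟩ := no_edge_and_weight_bound ha hsym hloop hy0 hy1 h0 hUeq hWeq hdeg hcom hr1
    hρr hcount hρ2
  refine ⟨fun w hw => (le_div_iff₀ hxs).1 (hA w hw), fun u v hu hv huv => ?_⟩
  have := hB u hu v hv
  rw [ha_one.2 huv] at this
  exact one_ne_zero this

end PerronSetup
end
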